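/- arXiv:2406.02769 — 2 statements merged into one kernel-verified Lean document; each statement's English description precedes it below -/
import Mathlib

section
/- Let v ∈ ℝ^d have all entries nonzero, with the joint empirical distribution (1/d)∑_{i=1}^d δ(v_i, θ*_i) converging in Wasserstein-2 distance (in probability) to a law Π_t on ℝ² having V ≠ 0 almost surely, and with the entries of θ* uniformly bounded. Let X ∈ ℝ^{n×d} have i.i.d. N(0,1) entries, ε ~ N(0, σ²I_n), independent of (v, θ*), and y = (1/√d)Xθ* + ε. Then, as n, d → ∞ with d/n = κ fixed, the optimal value min_{u ∈ ℝ^d} (1/n)‖y − (1/√d)X(u ⊙ v)‖₂² + (λ/d)‖u‖₂² converges in probability to P̄ = max_{τ≥0} min_{β≥0} [ τσ²/β + τβ(1 − κ) − τ² + τλ E_{(V,Θ)~Π_t}[(Θ² + β²κ)/(τV² + βλ)] ]. -/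
open MeasureTheory ProbabilityTheory Filter Topology NNReal ENNReal

noncomputable section

/-- A function `g : ℝ² → ℝ` is pseudo-Lipschitz of order 2 (PL(2)) with respect to the
Euclidean norm on ℝ². -/
def PseudoLipschitz2Pair (g : ℝ × ℝ → ℝ) : Prop :=
  ∃ C > (0 : ℝ), ∀ x y : ℝ × ℝ,
    |g x - g y| ≤
      C * (1 + Real.sqrt (x.1 ^ 2 + x.2 ^ 2) + Real.sqrt (y.1 ^ 2 + y.2 ^ 2)) *
        Real.sqrt ((x.1 - y.1) ^ 2 + (x.2 - y.2) ^ 2)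

/-- The scalar max–min objective
`φ(τ, β) = τσ²/β + τβ(1 − κ) − τ² + τλ E_{(V,Θ)~Π}[(Θ² + β²κ)/(τV² + βλ)]`. -/
def scalarObj (σ lam κ : ℝ) (Pit : Measure (ℝ × ℝ)) (τ β : ℝ) : ℝ :=
  τ * σ ^ 2 / β + τ * β * (1 - κ) - τ ^ 2 +
    τ * lam * ∫ p, (p.2 ^ 2 + β ^ 2 * κ) / (τ * p.1 ^ 2 + β * lam) ∂Pit

/-- The distribution of a batch `(X, ε)`, where `X ∈ ℝ^{n×d}` has i.i.d. `N(0,1)` entries and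
`ε ~ N(0, σ² I_n)`. -/
def batchMeasure (n d : ℕ) (σ : ℝ≥0) :
    Measure ((Fin n → Fin d → ℝ) × (Fin n → ℝ)) :=
  (Measure.pi fun _ : Fin n => Measure.pi fun _ : Fin d => gaussianReal 0 1).prod
    (Measure.pi fun _ : Fin n => gaussianReal 0 (σ ^ 2))


/-! ### Linear algebra -/

open Matrix in
/-- Symmetric matrices bounded below by the identity. -/
structure GeOne {n : ℕ} (A : Matrix (Fin n) (Fin n) ℝ) : Prop where
  symm : Aᵀ = A
  ge : ∀ z : Fin n → ℝ, z ⬝ᵥ z ≤ z ⬝ᵥ (A *ᵥ z)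

namespace GeOne

open Matrix

variable {n : ℕ} {A : Matrix (Fin n) (Fin n) ℝ}

lemma dot_self_nonneg (z : Fin n → ℝ) : 0 ≤ z ⬝ᵥ z :=
  Finset.sum_nonneg fun i _ => mul_self_nonneg (z i)

lemma isUnit_det (h : GeOne A) : IsUnit A.det := by
  rw [isUnit_iff_ne_zero]
  intro h0
  obtain ⟨v, hv, hv0⟩ := Matrix.exists_mulVec_eq_zero_iff.mpr h0
  have h1 := h.ge v
  rw [hv0, dotProduct_zero] at h1
  have h2 : v ⬝ᵥ v = 0 := le_antisymm h1 (dot_self_nonneg v)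
  exact hv (dotProduct_self_eq_zero.mp h2)

lemma mul_inv (h : GeOne A) : A * A⁻¹ = 1 := Matrix.mul_nonsing_inv A h.isUnit_det
lemma inv_mul (h : GeOne A) : A⁻¹ * A = 1 := Matrix.nonsing_inv_mul A h.isUnit_det

lemma mulVec_inv (h : GeOne A) (w : Fin n → ℝ) : A *ᵥ (A⁻¹ *ᵥ w) = w := by
  rw [mulVec_mulVec, h.mul_inv, one_mulVec]

lemma inv_mulVec (h : GeOne A) (w : Fin n → ℝ) : A⁻¹ *ᵥ (A *ᵥ w) = w := by
  rw [mulVec_mulVec, h.inv_mul, one_mulVec]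

lemma inv_symm (h : GeOne A) : (A⁻¹)ᵀ = A⁻¹ := by
  rw [Matrix.transpose_nonsing_inv, h.symm]

lemma inv_dot_comm (h : GeOne A) (x y : Fin n → ℝ) :
    x ⬝ᵥ (A⁻¹ *ᵥ y) = y ⬝ᵥ (A⁻¹ *ᵥ x) := by
  rw [dotProduct_mulVec, ← mulVec_transpose, h.inv_symm, dotProduct_comm]

lemma norm_le_dot (h : GeOne A) (w : Fin n → ℝ) :
    (A⁻¹ *ᵥ w) ⬝ᵥ (A⁻¹ *ᵥ w) ≤ w ⬝ᵥ (A⁻¹ *ᵥ w) := by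
  have h1 := h.ge (A⁻¹ *ᵥ w)
  rw [h.mulVec_inv] at h1
  rw [dotProduct_comm w]
  exact h1

lemma dot_nonneg (h : GeOne A) (w : Fin n → ℝ) : 0 ≤ w ⬝ᵥ (A⁻¹ *ᵥ w) :=
  (dot_self_nonneg _).trans (h.norm_le_dot w)

lemma dot_le (h : GeOne A) (w : Fin n → ℝ) : w ⬝ᵥ (A⁻¹ *ᵥ w) ≤ w ⬝ᵥ w := by
  have h1 := h.norm_le_dot w
  have h2 := dot_self_nonneg (w - A⁻¹ *ᵥ w)
  rw [sub_dotProduct, dotProduct_sub, dotProduct_sub, dotProduct_comm (A⁻¹ *ᵥ w) w] at h2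
  linarith

lemma norm_le (h : GeOne A) (w : Fin n → ℝ) :
    (A⁻¹ *ᵥ w) ⬝ᵥ (A⁻¹ *ᵥ w) ≤ w ⬝ᵥ w := (h.norm_le_dot w).trans (h.dot_le w)

lemma sum_sq_le (h : GeOne A) : ∑ i, ∑ j, (A⁻¹ i j) ^ 2 ≤ n := by
  rw [Finset.sum_comm]
  calc ∑ j, ∑ i, (A⁻¹ i j) ^ 2 ≤ ∑ _j : Fin n, (1 : ℝ) := by
        refine Finset.sum_le_sum fun j _ => ?_
        have h1 := h.norm_le (Pi.single j 1)
        rw [mulVec_single_one, single_one_dotProduct] at h1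
        simp only [dotProduct, Pi.single_eq_same, Matrix.col_apply] at h1
        simpa [sq] using h1
    _ = n := by simp

lemma diag_nonneg (h : GeOne A) (j : Fin n) : 0 ≤ A⁻¹ j j := by
  have h1 := h.dot_nonneg (Pi.single j 1)
  simpa using h1

lemma trace_nonneg (h : GeOne A) : 0 ≤ (A⁻¹).trace :=
  Finset.sum_nonneg fun j _ => h.diag_nonneg j

/-- rank one update -/
lemma add_rank_one (h : GeOne A) {a : ℝ} (ha : 0 ≤ a) (x : Fin n → ℝ) :
    GeOne (A + a • vecMulVec x x) where
  symm := by
    rw [transpose_add, h.symm, transpose_smul, transpose_vecMulVec]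
  ge z := by
    have h1 := h.ge z
    have h2 : z ⬝ᵥ ((A + a • vecMulVec x x) *ᵥ z) = z ⬝ᵥ (A *ᵥ z) + a * (x ⬝ᵥ z) ^ 2 := by
      rw [add_mulVec, dotProduct_add, smul_mulVec, vecMulVec_mulVec, dotProduct_smul]
      rw [op_smul_eq_smul, dotProduct_smul, dotProduct_comm z x]
      simp only [smul_eq_mul]; ring
    rw [h2]
    nlinarith [mul_nonneg ha (sq_nonneg (x ⬝ᵥ z))]

lemma rank_one_mulVec (h : GeOne A) {a : ℝ} (ha : 0 ≤ a) (x : Fin n → ℝ) :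
    A⁻¹ *ᵥ x = (1 + a * (x ⬝ᵥ (A⁻¹ *ᵥ x))) • ((A + a • vecMulVec x x)⁻¹ *ᵥ x) := by
  have h' := h.add_rank_one ha x
  have h1 : (A + a • vecMulVec x x) *ᵥ (A⁻¹ *ᵥ x) = (1 + a * (x ⬝ᵥ (A⁻¹ *ᵥ x))) • x := by
    rw [add_mulVec, h.mulVec_inv, smul_mulVec, vecMulVec_mulVec, op_smul_eq_smul, add_smul,
      one_smul, smul_smul]
  have h2 := h'.inv_mulVec (A⁻¹ *ᵥ x)
  rw [h1, mulVec_smul] at h2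
  exact h2.symm

lemma rank_one_dot (h : GeOne A) {a : ℝ} (ha : 0 ≤ a) (x y : Fin n → ℝ) :
    y ⬝ᵥ ((A + a • vecMulVec x x)⁻¹ *ᵥ x) =
      (y ⬝ᵥ (A⁻¹ *ᵥ x)) / (1 + a * (x ⬝ᵥ (A⁻¹ *ᵥ x))) := by
  have h0 : 0 < 1 + a * (x ⬝ᵥ (A⁻¹ *ᵥ x)) := by
    have := mul_nonneg ha (h.dot_nonneg x); linarith
  rw [eq_div_iff h0.ne']
  conv_rhs => rw [h.rank_one_mulVec ha x, dotProduct_smul, smul_eq_mul]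
  ring

lemma rank_one_trace (h : GeOne A) {a : ℝ} (ha : 0 ≤ a) (x : Fin n → ℝ) :
    |(A⁻¹).trace - ((A + a • vecMulVec x x)⁻¹).trace| ≤ 1 := by
  have h' := h.add_rank_one ha x
  set A' := A + a • vecMulVec x x with hA'
  set q := x ⬝ᵥ (A⁻¹ *ᵥ x) with hq
  have hq0 : 0 ≤ q := h.dot_nonneg x
  have h0 : 0 < 1 + a * q := by
    have := mul_nonneg ha hq0; linarith
  have e1 : A⁻¹ - A'⁻¹ = a • vecMulVec (A⁻¹ *ᵥ x) (A'⁻¹ *ᵥ x) := by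
    have : A⁻¹ - A'⁻¹ = A⁻¹ * (A' - A) * A'⁻¹ := by
      rw [mul_sub, sub_mul, h.inv_mul, one_mul, mul_assoc, h'.mul_inv, mul_one]
    rw [this, hA', add_sub_cancel_left, mul_smul_comm, smul_mul_assoc, mul_vecMulVec,
      vecMulVec_mul, ← mulVec_transpose, ← hA', h'.inv_symm]
  have e2 : (A⁻¹).trace - (A'⁻¹).trace = a * ((A⁻¹ *ᵥ x) ⬝ᵥ (A'⁻¹ *ᵥ x)) := by
    rw [← trace_sub, e1, trace_smul, trace_vecMulVec, smul_eq_mul]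
  have e3 := h.rank_one_mulVec ha x
  rw [← hA', ← hq] at e3
  have e4 : (1 + a * q) * ((A⁻¹ *ᵥ x) ⬝ᵥ (A'⁻¹ *ᵥ x)) = (A⁻¹ *ᵥ x) ⬝ᵥ (A⁻¹ *ᵥ x) := by
    conv_rhs => rhs; rw [e3]
    rw [dotProduct_smul, smul_eq_mul]
  have e5 := h.norm_le_dot x
  have e6 := dot_self_nonneg (A⁻¹ *ᵥ x)
  rw [← e4] at e5 e6
  rw [e2]
  set s := (A⁻¹ *ᵥ x) ⬝ᵥ (A'⁻¹ *ᵥ x)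
  have hs : 0 ≤ s := by
    by_contra hc; push Not at hc; nlinarith
  rw [abs_of_nonneg (mul_nonneg ha hs)]
  by_contra hc; push Not at hc
  nlinarith [mul_le_mul_of_nonneg_left e5 ha]

end GeOne

/-- The `k`-th column. -/
def colv {n d : ℕ} (X : Fin n → Fin d → ℝ) (k : Fin d) : Fin n → ℝ := fun i => X i k

open Matrix in
/-- `1 + ∑ a_k x_k x_kᵀ`. -/
def Amat {n d : ℕ} (a : Fin d → ℝ) (X : Fin n → Fin d → ℝ) : Matrix (Fin n) (Fin n) ℝ :=
  1 + ∑ k, a k • vecMulVec (colv X k) (colv X k)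

section Amat

open Matrix

variable {n d : ℕ} {a : Fin d → ℝ}

lemma geOne_Amat (ha : ∀ k, 0 ≤ a k) (X : Fin n → Fin d → ℝ) : GeOne (Amat a X) := by
  unfold Amat
  have : ∀ s : Finset (Fin d), GeOne (1 + ∑ k ∈ s, a k • vecMulVec (colv X k) (colv X k)) := by
    intro s
    induction s using Finset.induction_on with
    | empty => exact ⟨by simp, fun z => by simp⟩
    | insert k s hk ih =>
      rw [Finset.sum_insert hk, add_comm (a k • _), ← add_assoc]
      exact ih.add_rank_one (ha k) _
  exact this _

lemma Amat_eq_update (a : Fin d → ℝ) (X : Fin n → Fin d → ℝ) (k : Fin d) :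
    Amat a X = Amat (Function.update a k 0) X + a k • vecMulVec (colv X k) (colv X k) := by
  unfold Amat
  rw [add_assoc]
  congr 1
  rw [← Finset.sum_erase_add _ _ (Finset.mem_univ k),
    ← Finset.sum_erase_add (Finset.univ) (fun l => Function.update a k 0 l • _) (Finset.mem_univ k)]
  simp only [Function.update_self, zero_smul, add_zero]
  congr 1
  refine Finset.sum_congr rfl fun l hl => ?_
  rw [Function.update_of_ne (Finset.ne_of_mem_erase hl)]

lemma update_nonneg (ha : ∀ k, 0 ≤ a k) (k : Fin d) : ∀ l, 0 ≤ Function.update a k 0 l := by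
  intro l
  by_cases h : l = k
  · subst h; simp
  · rw [Function.update_of_ne h]; exact ha l

/-- Replace column `k` of `X` by `z`. -/
def setCol (k : Fin d) (X : Fin n → Fin d → ℝ) (z : Fin n → ℝ) : Fin n → Fin d → ℝ :=
  fun i => Function.update (X i) k (z i)

lemma colv_setCol_self (k : Fin d) (X : Fin n → Fin d → ℝ) (z : Fin n → ℝ) :
    colv (setCol k X z) k = z := by
  ext i; simp [colv, setCol]

lemma colv_setCol_ne {k l : Fin d} (h : l ≠ k) (X : Fin n → Fin d → ℝ) (z : Fin n → ℝ) :
    colv (setCol k X z) l = colv X l := by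
  ext i; simp [colv, setCol, h]

lemma Amat_setCol (k : Fin d) (X : Fin n → Fin d → ℝ) (z : Fin n → ℝ) :
    Amat (Function.update a k 0) (setCol k X z) = Amat (Function.update a k 0) X := by
  unfold Amat
  congr 1
  refine Finset.sum_congr rfl fun l _ => ?_
  by_cases h : l = k
  · subst h; simp
  · rw [colv_setCol_ne h]

lemma Amat_mulVec (a : Fin d → ℝ) (X : Fin n → Fin d → ℝ) (z : Fin n → ℝ) :
    Amat a X *ᵥ z = z + ∑ k, (a k * (colv X k ⬝ᵥ z)) • colv X k := by
  unfold Amat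
  rw [add_mulVec, one_mulVec, sum_mulVec]
  congr 1
  refine Finset.sum_congr rfl fun k _ => ?_
  rw [smul_mulVec, vecMulVec_mulVec, op_smul_eq_smul, smul_smul]

/-- `q_k / n`-type quantity: leave-one-out quadratic form. -/
def qk (a : Fin d → ℝ) (X : Fin n → Fin d → ℝ) (k : Fin d) : ℝ :=
  colv X k ⬝ᵥ ((Amat (Function.update a k 0) X)⁻¹ *ᵥ colv X k)

lemma qk_nonneg (ha : ∀ k, 0 ≤ a k) (X : Fin n → Fin d → ℝ) (k : Fin d) : 0 ≤ qk a X k :=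
  (geOne_Amat (update_nonneg ha k) X).dot_nonneg _

lemma dot_self_eq (ha : ∀ k, 0 ≤ a k) (X : Fin n → Fin d → ℝ) (k : Fin d) :
    colv X k ⬝ᵥ ((Amat a X)⁻¹ *ᵥ colv X k) = qk a X k / (1 + a k * qk a X k) := by
  rw [Amat_eq_update a X k]
  exact (geOne_Amat (update_nonneg ha k) X).rank_one_dot (ha k) _ _

lemma sq_dot_le (ha : ∀ k, 0 ≤ a k) (X : Fin n → Fin d → ℝ) (k l : Fin d) :
    (colv X l ⬝ᵥ ((Amat a X)⁻¹ *ᵥ colv X k)) ^ 2 ≤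
      (colv X l ⬝ᵥ ((Amat (Function.update a k 0) X)⁻¹ *ᵥ colv X k)) ^ 2 := by
  rw [Amat_eq_update a X k, (geOne_Amat (update_nonneg ha k) X).rank_one_dot (ha k), div_pow]
  refine div_le_self (sq_nonneg _) ?_
  have := mul_nonneg (ha k) (qk_nonneg ha X k)
  unfold qk at this
  nlinarith

lemma trace_diff_le (ha : ∀ k, 0 ≤ a k) (X : Fin n → Fin d → ℝ) (k : Fin d) :
    |((Amat (Function.update a k 0) X)⁻¹).trace - ((Amat a X)⁻¹).trace| ≤ 1 := by
  rw [Amat_eq_update a X k]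
  exact (geOne_Amat (update_nonneg ha k) X).rank_one_trace (ha k) _

lemma trace_identity (ha : ∀ k, 0 ≤ a k) (X : Fin n → Fin d → ℝ) :
    ((Amat a X)⁻¹).trace + ∑ k, a k * (colv X k ⬝ᵥ ((Amat a X)⁻¹ *ᵥ colv X k)) = n := by
  have h := geOne_Amat ha X
  have h1 : (Amat a X * (Amat a X)⁻¹).trace = n := by rw [h.mul_inv]; simp
  rw [← h1]
  have e : Amat a X * (Amat a X)⁻¹ =
      (1 + ∑ k, a k • vecMulVec (colv X k) (colv X k)) * (Amat a X)⁻¹ := rfl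
  rw [e, add_mul, one_mul, trace_add, Finset.sum_mul, trace_sum]
  congr 1
  refine Finset.sum_congr rfl fun k _ => ?_
  rw [smul_mul_assoc, trace_smul, vecMulVec_mul, trace_vecMulVec, ← mulVec_transpose, h.inv_symm,
    smul_eq_mul]

/-- The ridge minimum is a quadratic form. -/
lemma ridge_min (c m : ℝ) (hc : 0 < c) (hm : 0 < m) (b : Fin d → ℝ)
    (hab : ∀ k, a k = b k ^ 2 * (c / m)) (ha : ∀ k, 0 ≤ a k)
    (X : Fin n → Fin d → ℝ) (y : Fin n → ℝ) :
    (⨅ u : Fin d → ℝ, (c * ∑ i, (y i - ∑ k, X i k * (u k * b k)) ^ 2 + m * ∑ k, u k ^ 2))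
      = c * (y ⬝ᵥ ((Amat a X)⁻¹ *ᵥ y)) := by
  have h := geOne_Amat ha X
  set z := (Amat a X)⁻¹ *ᵥ y with hz
  have hAz : Amat a X *ᵥ z = y := h.mulVec_inv y
  rw [Amat_mulVec] at hAz
  have hy : ∀ i, y i = z i + ∑ k, a k * (colv X k ⬝ᵥ z) * X i k := by
    intro i
    conv_lhs => rw [← hAz]
    simp [colv]
  have hyz : y ⬝ᵥ z = ∑ i, z i ^ 2 + ∑ k, a k * (colv X k ⬝ᵥ z) ^ 2 := by
    conv_lhs => rw [← hAz]
    rw [add_dotProduct, sum_dotProduct]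
    congr 1
    · simp [dotProduct, sq]
    · refine Finset.sum_congr rfl fun k _ => ?_
      rw [smul_dotProduct, smul_eq_mul]; ring
  have key : ∀ u : Fin d → ℝ,
      c * ∑ i, (y i - ∑ k, X i k * (u k * b k)) ^ 2 + m * ∑ k, u k ^ 2 =
      c * (y ⬝ᵥ z) + (c * ∑ i, (y i - ∑ k, X i k * (u k * b k) - z i) ^ 2
        + m * ∑ k, (u k - (c / m) * b k * (colv X k ⬝ᵥ z)) ^ 2) := by
    intro u
    have e1 : ∀ i, (y i - ∑ k, X i k * (u k * b k)) ^ 2 =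
        (y i - ∑ k, X i k * (u k * b k) - z i) ^ 2 +
        2 * (z i * y i) - 2 * (z i * ∑ k, X i k * (u k * b k)) - z i ^ 2 := by
      intro i; ring
    have e2 : ∀ k, u k ^ 2 = (u k - (c / m) * b k * (colv X k ⬝ᵥ z)) ^ 2
        + 2 * ((c / m) * (u k * b k * (colv X k ⬝ᵥ z))) 
        - (c / m) * (a k * (colv X k ⬝ᵥ z) ^ 2) := by
      intro k; rw [hab]; ring
    have e3 : ∑ i, z i * ∑ k, X i k * (u k * b k) = ∑ k, u k * b k * (colv X k ⬝ᵥ z) := by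
      simp only [Finset.mul_sum, dotProduct, colv]
      rw [Finset.sum_comm]
      refine Finset.sum_congr rfl fun k _ => Finset.sum_congr rfl fun i _ => ?_
      ring
    have e4 : ∑ i, z i * y i = y ⬝ᵥ z := by
      rw [dotProduct_comm]; rfl
    have e5 : ∑ i, (y i - ∑ k, X i k * (u k * b k)) ^ 2 =
        ∑ i, (y i - ∑ k, X i k * (u k * b k) - z i) ^ 2 +
        2 * (y ⬝ᵥ z) - 2 * ∑ k, u k * b k * (colv X k ⬝ᵥ z) - ∑ i, z i ^ 2 := by
      rw [Finset.sum_congr rfl fun i _ => e1 i, Finset.sum_sub_distrib, Finset.sum_sub_distrib,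
        Finset.sum_add_distrib, ← Finset.mul_sum, ← Finset.mul_sum, e3, e4]
    have e6 : ∑ k, u k ^ 2 = ∑ k, (u k - (c / m) * b k * (colv X k ⬝ᵥ z)) ^ 2
        + 2 * ((c / m) * ∑ k, (u k * b k * (colv X k ⬝ᵥ z))) 
        - (c / m) * ∑ k, (a k * (colv X k ⬝ᵥ z) ^ 2) := by
      rw [Finset.sum_congr rfl fun k _ => e2 k, Finset.sum_sub_distrib,
        Finset.sum_add_distrib, ← Finset.mul_sum, ← Finset.mul_sum, ← Finset.mul_sum]
    rw [e5, e6, hyz]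
    field_simp
    ring
  apply le_antisymm
  · have hb : BddBelow (Set.range fun u : Fin d → ℝ =>
        c * ∑ i, (y i - ∑ k, X i k * (u k * b k)) ^ 2 + m * ∑ k, u k ^ 2) := by
      refine ⟨0, ?_⟩
      rintro _ ⟨u, rfl⟩
      positivity
    refine (ciInf_le hb (fun k => (c / m) * b k * (colv X k ⬝ᵥ z))).trans ?_
    rw [key]
    have : ∀ i, y i - ∑ k, X i k * (((c / m) * b k * (colv X k ⬝ᵥ z)) * b k) - z i = 0 := by
      intro i
      conv_lhs => lhs; lhs; rw [hy i]
      have : ∑ k, a k * (colv X k ⬝ᵥ z) * X i k =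
          ∑ k, X i k * (((c / m) * b k * (colv X k ⬝ᵥ z)) * b k) := by
        refine Finset.sum_congr rfl fun k _ => ?_
        rw [hab]; ring
      rw [this]; ring
    simp [this]
  · refine le_ciInf fun u => ?_
    rw [key]
    have : 0 ≤ c * ∑ i, (y i - ∑ k, X i k * (u k * b k) - z i) ^ 2
        + m * ∑ k, (u k - (c / m) * b k * (colv X k ⬝ᵥ z)) ^ 2 := by positivity
    linarith

end Amat

/-! ### Probability tools -/

lemma integral_sum_sq_le {Ω ι : Type*} [MeasurableSpace Ω] [Fintype ι] [DecidableEq ι]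
    (μ : Measure Ω) (f : ι → Ω → ℝ) (τ : ι → ι) (hτ : Function.Involutive τ)
    (hf : ∀ a, MemLp (f a) 2 μ)
    (h0 : ∀ a b, b ≠ a → b ≠ τ a → ∫ x, f a x * f b x ∂μ = 0) :
    ∫ x, (∑ a, f a x) ^ 2 ∂μ ≤ 2 * ∑ a, ∫ x, (f a x) ^ 2 ∂μ := by
  have hintg : ∀ a b, Integrable (fun x => f a x * f b x) μ := fun a b =>
    (hf a).integrable_mul (hf b)
  have hsq : ∀ a, Integrable (fun x => (f a x) ^ 2) μ := fun a => (hf a).integrable_sq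
  set e : ι → ℝ := fun a => ∫ x, (f a x) ^ 2 ∂μ with he
  have e0 : ∀ a, 0 ≤ e a := fun a => integral_nonneg fun x => sq_nonneg _
  have hle : ∀ a b, ∫ x, f a x * f b x ∂μ ≤ (e a + e b) / 2 := by
    intro a b
    have : (e a + e b) / 2 = ∫ x, ((f a x) ^ 2 + (f b x) ^ 2) / 2 ∂μ := by
      rw [integral_div, integral_add (hsq a) (hsq b)]
    rw [this]
    refine integral_mono (hintg a b) (((hsq a).add (hsq b)).div_const 2) fun x => ?_
    simp only
    nlinarith [sq_nonneg (f a x - f b x)]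
  have h1 : ∫ x, (∑ a, f a x) ^ 2 ∂μ = ∑ a, ∑ b, ∫ x, f a x * f b x ∂μ := by
    have : ∀ x, (∑ a, f a x) ^ 2 = ∑ a, ∑ b, f a x * f b x := by
      intro x; rw [sq, Finset.sum_mul_sum]
    simp_rw [this]
    rw [integral_finsetSum _ fun a _ => integrable_finsetSum _ fun b _ => hintg a b]
    refine Finset.sum_congr rfl fun a _ => ?_
    rw [integral_finsetSum _ fun b _ => hintg a b]
  rw [h1]
  have h2 : ∀ a b, ∫ x, f a x * f b x ∂μ ≤
      (if b = a then (e a + e b) / 2 else 0) + (if b = τ a then (e a + e b) / 2 else 0) := by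
    intro a b
    have h3 := hle a b
    have h4 : 0 ≤ (e a + e b) / 2 := by have := e0 a; have := e0 b; positivity
    by_cases h5 : b = a
    · rw [if_pos h5]; split_ifs <;> linarith
    · by_cases h6 : b = τ a
      · rw [if_neg h5, if_pos h6]; linarith
      · rw [if_neg h5, if_neg h6, h0 a b h5 h6]; simp
  calc ∑ a, ∑ b, ∫ x, f a x * f b x ∂μ
      ≤ ∑ a, ∑ b, ((if b = a then (e a + e b) / 2 else 0) +
          (if b = τ a then (e a + e b) / 2 else 0)) :=
        Finset.sum_le_sum fun a _ => Finset.sum_le_sum fun b _ => h2 a b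
    _ = ∑ a, ((e a + e a) / 2 + (e a + e (τ a)) / 2) := by
        refine Finset.sum_congr rfl fun a _ => ?_
        rw [Finset.sum_add_distrib]; simp
    _ = 2 * ∑ a, e a := by
        have : ∑ a, e (τ a) = ∑ a, e a := Equiv.sum_comp hτ.toPerm e
        have h7 : ∀ a, (e a + e a) / 2 + (e a + e (τ a)) / 2 = 3 / 2 * e a + 1 / 2 * e (τ a) := by
          intro a; ring
        simp_rw [h7]
        rw [Finset.sum_add_distrib, ← Finset.mul_sum, ← Finset.mul_sum, this]
        ring

lemma lintegral_sum_sq_le {Ω ι : Type*} [MeasurableSpace Ω] [Fintype ι] [DecidableEq ι]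
    (μ : Measure Ω) (f : ι → Ω → ℝ) (τ : ι → ι) (hτ : Function.Involutive τ)
    (hf : ∀ a, MemLp (f a) 2 μ)
    (h0 : ∀ a b, b ≠ a → b ≠ τ a → ∫ x, f a x * f b x ∂μ = 0) :
    ∫⁻ x, ENNReal.ofReal ((∑ a, f a x) ^ 2) ∂μ ≤
      ENNReal.ofReal (2 * ∑ a, ∫ x, (f a x) ^ 2 ∂μ) := by
  have hs : MemLp (fun x => ∑ a, f a x) 2 μ := memLp_finsetSum _ fun a _ => hf a
  rw [← ofReal_integral_eq_lintegral_ofReal hs.integrable_sq (ae_of_all _ fun x => sq_nonneg _)]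
  exact ENNReal.ofReal_le_ofReal (integral_sum_sq_le μ f τ hτ hf h0)

/-- If a measure preserving map flips the sign of `g`, its integral vanishes. -/
lemma integral_eq_zero_of_flip {Ω : Type*} [MeasurableSpace Ω] {μ : Measure Ω} {φ : Ω → Ω}
    (hφ : MeasurePreserving φ μ μ) {g : Ω → ℝ} (hg : Measurable g) (h : ∀ x, g (φ x) = - g x) :
    ∫ x, g x ∂μ = 0 := by
  have h1 : ∫ x, g (φ x) ∂μ = ∫ x, g x ∂μ := by
    conv_rhs => rw [← hφ.map_eq]
    rw [integral_map hφ.measurable.aemeasurable hg.aestronglyMeasurable]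
  simp_rw [h, integral_neg] at h1
  linarith

/-- L¹ from L². -/
lemma lintegral_abs_le {Ω : Type*} [MeasurableSpace Ω] {μ : Measure Ω} [IsProbabilityMeasure μ]
    {f : Ω → ℝ} (hf : Measurable f) {c : ℝ} (hc : 0 < c)
    (h : ∫⁻ x, ENNReal.ofReal ((f x) ^ 2) ∂μ ≤ ENNReal.ofReal (c ^ 2)) :
    ∫⁻ x, ENNReal.ofReal |f x| ∂μ ≤ ENNReal.ofReal c := by
  calc ∫⁻ x, ENNReal.ofReal |f x| ∂μ
      ≤ ∫⁻ x, (ENNReal.ofReal (1 / (2 * c)) * ENNReal.ofReal ((f x) ^ 2) +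
          ENNReal.ofReal (c / 2)) ∂μ := by
        refine lintegral_mono fun x => ?_
        rw [← ENNReal.ofReal_mul (by positivity), ← ENNReal.ofReal_add (by positivity)
          (by positivity)]
        refine ENNReal.ofReal_le_ofReal ?_
        have : 1 / (2 * c) * f x ^ 2 + c / 2 - |f x| = (|f x| - c) ^ 2 / (2 * c) := by
          rw [← sq_abs (f x)]; field_simp; ring
        have h2 : 0 ≤ (|f x| - c) ^ 2 / (2 * c) := by positivity
        linarith
    _ ≤ ENNReal.ofReal (1 / (2 * c)) * ENNReal.ofReal (c ^ 2) + ENNReal.ofReal (c / 2) := by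
        rw [lintegral_add_right _ measurable_const, lintegral_const_mul _ (by fun_prop)]
        simp only [lintegral_const, measure_univ, mul_one]
        gcongr
    _ = ENNReal.ofReal c := by
        rw [← ENNReal.ofReal_mul (by positivity), ← ENNReal.ofReal_add (by positivity)
          (by positivity)]
        congr 1; field_simp; ring

section gauss

variable {n d : ℕ} (s : ℝ≥0)

/-- standard product Gaussian on `ℝⁿ` with variance `s`. -/
abbrev gvec (n : ℕ) (s : ℝ≥0) : Measure (Fin n → ℝ) := Measure.pi fun _ : Fin n => gaussianReal 0 s

lemma mp_neg : MeasurePreserving (fun x : ℝ => -x) (gaussianReal 0 s) (gaussianReal 0 s) :=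
  ⟨by fun_prop, by rw [gaussianReal_map_neg, neg_zero]⟩

/-- flip one coordinate -/
def flipc (m : Fin n) (x : Fin n → ℝ) : Fin n → ℝ := fun i => if i = m then - x i else x i

lemma mp_flipc (m : Fin n) : MeasurePreserving (flipc m) (gvec n s) (gvec n s) := by
  have h := measurePreserving_pi (fun _ : Fin n => gaussianReal 0 s)
    (fun _ : Fin n => gaussianReal 0 s) (f := fun i x => if i = m then - x else x) ?_
  · exact h
  · intro i
    by_cases h : i = m
    · simp only [h, if_true]; exact mp_neg s
    · simp only [h, if_false]; exact MeasurePreserving.id _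

lemma integrable_pow_gauss (p : ℕ) : Integrable (fun x : ℝ => x ^ p) (gaussianReal 0 s) := by
  have h := (memLp_id_gaussianReal (μ := 0) (v := s) (p : ℝ≥0))
  by_cases hp : p = 0
  · subst hp; simp
  have h2 := h.integrable_norm_rpow (by simpa using hp) (by simp)
  have h3 : Integrable (fun x : ℝ => ‖x‖ ^ p) (gaussianReal 0 s) := by simpa using h2
  refine h3.mono' (by fun_prop) (ae_of_all _ fun x => by simp)

lemma integrable_pow_coord (p : ℕ) (i : Fin n) :
    Integrable (fun x : Fin n → ℝ => x i ^ p) (gvec n s) :=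
  (measurePreserving_eval (fun _ : Fin n => gaussianReal 0 s) i).integrable_comp_of_integrable
    (integrable_pow_gauss s p)

lemma integral_coord (i : Fin n) (g : ℝ → ℝ) (hg : Measurable g) :
    ∫ x : Fin n → ℝ, g (x i) ∂(gvec n s) = ∫ x, g x ∂(gaussianReal 0 s) := by
  have h := measurePreserving_eval (fun _ : Fin n => gaussianReal 0 s) i
  conv_rhs => rw [← h.map_eq]
  rw [integral_map h.measurable.aemeasurable hg.aestronglyMeasurable]

lemma integral_sq_gauss : ∫ x, x ^ 2 ∂(gaussianReal 0 s) = s := by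
  have h := variance_id_gaussianReal (μ := 0) (v := s)
  rw [variance_eq_integral (by fun_prop)] at h
  simpa using h

lemma integral_sq_coord (i : Fin n) : ∫ x : Fin n → ℝ, x i ^ 2 ∂(gvec n s) = s := by
  rw [integral_coord s i (fun x => x ^ 2) (by fun_prop), integral_sq_gauss]

/-- linear form second moment -/
lemma lin_form (w : Fin n → ℝ) :
    ∫⁻ z, ENNReal.ofReal ((w ⬝ᵥ z) ^ 2) ∂(gvec n s) ≤ ENNReal.ofReal (2 * (s * (w ⬝ᵥ w))) := by
  have hm : ∀ i, MemLp (fun z : Fin n → ℝ => w i * z i) 2 (gvec n s) := by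
    intro i
    refine MemLp.const_mul ?_ _
    rw [memLp_two_iff_integrable_sq (measurable_pi_apply i).aestronglyMeasurable]
    exact integrable_pow_coord s 2 i
  have h := lintegral_sum_sq_le (gvec n s) (fun i z => w i * z i) id (fun _ => rfl) hm ?_
  · refine h.trans (ENNReal.ofReal_le_ofReal ?_)
    refine le_of_eq ?_
    congr 1
    simp only [dotProduct, Finset.mul_sum]
    refine Finset.sum_congr rfl fun i _ => ?_
    simp_rw [mul_pow]
    rw [integral_const_mul, integral_sq_coord]; ring
  · intro a b hab _
    refine integral_eq_zero_of_flip (mp_flipc s a) (by fun_prop) fun x => ?_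
    simp [flipc, hab]

/-- the constant of the quadratic form bound -/
def Kq (s : ℝ≥0) : ℝ := 4 * (∫ x, x ^ 4 ∂(gaussianReal 0 s) + (s : ℝ) ^ 2)

lemma Kq_nonneg : 0 ≤ Kq s := by
  unfold Kq
  have : 0 ≤ ∫ x, x ^ 4 ∂(gaussianReal 0 s) := integral_nonneg fun x => by positivity
  positivity

open Matrix in
lemma quad_form (P : Matrix (Fin n) (Fin n) ℝ) :
    ∫⁻ z, ENNReal.ofReal ((z ⬝ᵥ (P *ᵥ z) - s * P.trace) ^ 2) ∂(gvec n s) ≤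
      ENNReal.ofReal (Kq s * ∑ i, ∑ j, P i j ^ 2) := by
  set m4 := ∫ x, x ^ 4 ∂(gaussianReal 0 s) with hm4
  let g : Fin n × Fin n → (Fin n → ℝ) → ℝ := fun a z =>
    z a.1 * z a.2 - if a.1 = a.2 then (s : ℝ) else 0
  have hgm : ∀ a, Measurable (g a) := by intro a; simp only [g]; fun_prop
  have hgb : ∀ a z, (g a z) ^ 2 ≤ z a.1 ^ 4 + z a.2 ^ 4 + 2 * (s : ℝ) ^ 2 := by
    intro a z
    simp only [g]
    have h1 : (z a.1 * z a.2) ^ 2 ≤ (z a.1 ^ 4 + z a.2 ^ 4) / 2 := by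
      nlinarith [sq_nonneg (z a.1 ^ 2 - z a.2 ^ 2)]
    split_ifs with h
    · nlinarith [sq_nonneg (z a.1 * z a.2 + s)]
    · nlinarith [sq_nonneg (s : ℝ), sq_nonneg (z a.1 ^ 2), sq_nonneg (z a.2 ^ 2)]
  have hbi : ∀ a : Fin n × Fin n, Integrable (fun z : Fin n → ℝ =>
      z a.1 ^ 4 + z a.2 ^ 4 + 2 * (s : ℝ) ^ 2) (gvec n s) := fun a =>
    ((integrable_pow_coord s 4 a.1).add (integrable_pow_coord s 4 a.2)).add (integrable_const _)
  have hgi : ∀ a, Integrable (fun z => (g a z) ^ 2) (gvec n s) := by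
    intro a
    refine (hbi a).mono' ((hgm a).pow_const 2).aestronglyMeasurable (ae_of_all _ fun z => ?_)
    rw [Real.norm_of_nonneg (sq_nonneg _)]
    exact hgb a z
  have hgl : ∀ a, MemLp (g a) 2 (gvec n s) := fun a =>
    (memLp_two_iff_integrable_sq (hgm a).aestronglyMeasurable).2 (hgi a)
  have hge : ∀ a, ∫ z, (g a z) ^ 2 ∂(gvec n s) ≤ 2 * (m4 + (s : ℝ) ^ 2) := by
    intro a
    refine (integral_mono (hgi a) (hbi a) (hgb a)).trans ?_
    rw [integral_add (f := fun z : Fin n → ℝ => z a.1 ^ 4 + z a.2 ^ 4)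
      ((integrable_pow_coord s 4 a.1).add (integrable_pow_coord s 4 a.2))
      (integrable_const _), integral_add (integrable_pow_coord s 4 a.1)
      (integrable_pow_coord s 4 a.2), integral_coord s a.1 (fun x => x ^ 4) (by fun_prop),
      integral_coord s a.2 (fun x => x ^ 4) (by fun_prop)]
    simp only [integral_const, probReal_univ, smul_eq_mul, one_mul]
    linarith
  have h := lintegral_sum_sq_le (gvec n s) (fun a z => P a.1 a.2 * g a z) Prod.swap
    (fun _ => rfl) (fun a => (hgl a).const_mul _) ?_
  · have e1 : ∀ z : Fin n → ℝ, z ⬝ᵥ (P *ᵥ z) - s * P.trace = ∑ a : Fin n × Fin n, P a.1 a.2 * g a z := by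
      intro z
      rw [Fintype.sum_prod_type]
      simp only [g, mul_sub, Finset.sum_sub_distrib, dotProduct, mulVec, trace, Finset.mul_sum,
        mul_ite, mul_zero, Finset.sum_ite_eq, Finset.mem_univ, if_true, diag_apply]
      congr 1
      · refine Finset.sum_congr rfl fun i _ => Finset.sum_congr rfl fun j _ => ?_
        ring
      · refine Finset.sum_congr rfl fun i _ => ?_
        ring
    simp_rw [e1]
    refine h.trans (ENNReal.ofReal_le_ofReal ?_)
    have e2 : ∑ a : Fin n × Fin n, ∫ z, (P a.1 a.2 * g a z) ^ 2 ∂(gvec n s) ≤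
        ∑ a : Fin n × Fin n, P a.1 a.2 ^ 2 * (2 * (m4 + (s : ℝ) ^ 2)) := by
      refine Finset.sum_le_sum fun a _ => ?_
      simp_rw [mul_pow]
      rw [integral_const_mul]
      exact mul_le_mul_of_nonneg_left (hge a) (sq_nonneg _)
    have e3 : ∑ a : Fin n × Fin n, P a.1 a.2 ^ 2 = ∑ i, ∑ j, P i j ^ 2 := by
      rw [Fintype.sum_prod_type]
    rw [← Finset.sum_mul, e3] at e2
    unfold Kq
    linarith
  · intro a b hab hab'
    have hmeas : Measurable fun x => P a.1 a.2 * g a x * (P b.1 b.2 * g b x) :=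
      ((hgm a).const_mul _).mul ((hgm b).const_mul _)
    obtain ⟨i, j⟩ := a
    obtain ⟨k, l⟩ := b
    simp only [ne_eq, Prod.mk.injEq, Prod.swap_prod_mk, not_and] at hab hab'
    by_cases hij : i = j
    · by_cases hkl : k = l
      · subst hij; subst hkl
        have hik : i ≠ k := fun h => hab h.symm h.symm
        have hind : IndepFun (fun x : Fin n → ℝ => x i) (fun x => x k) (gvec n s) :=
          (iIndepFun_pi (μ := fun _ : Fin n => gaussianReal 0 s) (X := fun _ x => x)
            (fun _ => by fun_prop)).indepFun hik
        have hind2 := hind.comp (φ := fun x => P i i * (x * x - s))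
          (ψ := fun x => P k k * (x * x - s)) (by fun_prop) (by fun_prop)
        have := hind2.integral_fun_mul_eq_mul_integral (by fun_prop) (by fun_prop)
        simp only [Function.comp_def] at this
        simp only [g, if_true]
        rw [this]
        have hz : ∫ x : Fin n → ℝ, P i i * (x i * x i - s) ∂(gvec n s) = 0 := by
          rw [integral_const_mul]
          have := integral_sub (integrable_pow_coord (n := n) s 2 i) (integrable_const (s : ℝ))
          rw [integral_sq_coord] at this
          simp only [integral_const, probReal_univ, smul_eq_mul, one_mul, sub_self,
            sq] at this
          rw [this, mul_zero]
        rw [hz, zero_mul]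
      · -- k ≠ l
        have : k ≠ i ∨ l ≠ i := by
          by_contra hc; push Not at hc; exact hkl (hc.1.trans hc.2.symm)
        rcases this with h | h
        · refine integral_eq_zero_of_flip (mp_flipc s k) hmeas fun x => ?_
          simp only [g, flipc]
          have h1 : i ≠ k := fun h' => h h'.symm
          have h2 : j ≠ k := fun h' => h (by rw [hij, h'])
          have h3 : l ≠ k := fun h' => hkl h'.symm
          simp [h1, h2, h3, hkl]
        · refine integral_eq_zero_of_flip (mp_flipc s l) hmeas fun x => ?_
          simp only [g, flipc]
          have h1 : i ≠ l := fun h' => h h'.symm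
          have h2 : j ≠ l := fun h' => h (by rw [hij, h'])
          simp [h1, h2, hkl]
    · by_cases h : i = k ∨ i = l
      · have hj : j ≠ k ∧ j ≠ l := by
          constructor
          · rintro rfl
            rcases h with h | h
            · exact hij h
            · exact hab' rfl h.symm
          · rintro rfl
            rcases h with h | h
            · exact hab h.symm rfl
            · exact hij h
        refine integral_eq_zero_of_flip (mp_flipc s j) hmeas fun x => ?_
        simp only [g, flipc]
        simp [hij, hj.1.symm, hj.2.symm]
      · push Not at h
        refine integral_eq_zero_of_flip (mp_flipc s i) hmeas fun x => ?_
        simp only [g, flipc]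
        have h3 : j ≠ i := fun h' => hij h'.symm
        simp [hij, h3, h.1.symm, h.2.symm]

end gauss

/-! ### Random matrix estimates -/

section rmt

open Matrix

variable {n d : ℕ}

/-- Law of the design matrix. -/
abbrev gmat (n d : ℕ) : Measure (Fin n → Fin d → ℝ) :=
  Measure.pi fun _ : Fin n => gvec d 1

lemma mp_update (k : Fin d) :
    MeasurePreserving (fun p : (Fin d → ℝ) × ℝ => Function.update p.1 k p.2)
      ((gvec d 1).prod (gaussianReal 0 1)) (gvec d 1) := by
  have hmeas : Measurable (fun p : (Fin d → ℝ) × ℝ => Function.update p.1 k p.2) := by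
    rw [measurable_pi_iff]
    intro l
    by_cases h : l = k
    · subst h; simpa using measurable_snd
    · simp only [Function.update_of_ne h]; fun_prop
  refine ⟨hmeas, ?_⟩
  symm
  refine Measure.pi_eq fun s hs => ?_
  rw [Measure.map_apply hmeas (MeasurableSet.univ_pi hs)]
  have : (fun p : (Fin d → ℝ) × ℝ => Function.update p.1 k p.2) ⁻¹' (Set.univ.pi s) =
      (Set.univ.pi (Function.update s k Set.univ)) ×ˢ (s k) := by
    ext ⟨x, z⟩
    simp only [Set.mem_preimage, Set.mem_pi, Set.mem_univ, true_imp_iff, Set.mem_prod]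
    constructor
    · intro h
      refine ⟨fun l => ?_, by simpa using h k⟩
      by_cases hl : l = k
      · subst hl; simp
      · simpa [hl] using h l
    · rintro ⟨h1, h2⟩ l
      by_cases hl : l = k
      · subst hl; simpa using h2
      · simpa [hl] using h1 l
  rw [this, Measure.prod_prod, Measure.pi_pi]
  rw [← Finset.prod_erase_mul _ _ (Finset.mem_univ k)]
  rw [← Finset.prod_erase_mul Finset.univ (fun i => gaussianReal 0 1 (s i)) (Finset.mem_univ k)]
  simp only [Function.update_self, measure_univ, mul_one]
  congr 1
  refine Finset.prod_congr rfl fun l hl => ?_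
  rw [Function.update_of_ne (Finset.ne_of_mem_erase hl)]

lemma mp_setCol (k : Fin d) :
    MeasurePreserving (fun p : (Fin n → Fin d → ℝ) × (Fin n → ℝ) => setCol k p.1 p.2)
      ((gmat n d).prod (gvec n 1)) (gmat n d) := by
  have h1 := measurePreserving_pi (fun _ : Fin n => (gvec d 1).prod (gaussianReal 0 1))
    (fun _ : Fin n => gvec d 1) (fun _ => mp_update k)
  have h2 := (measurePreserving_arrowProdEquivProdArrow (Fin d → ℝ) ℝ (Fin n)
    (fun _ => gvec d 1) (fun _ => gaussianReal 0 1)).symm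
  exact h1.comp h2

lemma lintegral_setCol (k : Fin d) {f : (Fin n → Fin d → ℝ) → ℝ≥0∞} (hf : Measurable f) :
    ∫⁻ X, f X ∂(gmat n d) = ∫⁻ X, ∫⁻ z, f (setCol k X z) ∂(gvec n 1) ∂(gmat n d) := by
  rw [← (mp_setCol k).lintegral_comp hf]
  exact lintegral_prod (fun p : (Fin n → Fin d → ℝ) × (Fin n → ℝ) => f (setCol k p.1 p.2))
    (hf.comp (mp_setCol k).measurable).aemeasurable

/-- Flip the sign of column `m`. -/
def flipCol (m : Fin d) (X : Fin n → Fin d → ℝ) : Fin n → Fin d → ℝ := fun i => flipc m (X i)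

lemma mp_flipCol (m : Fin d) : MeasurePreserving (flipCol m) (gmat n d) (gmat n d) :=
  measurePreserving_pi (fun _ : Fin n => gvec d 1) (fun _ : Fin n => gvec d 1)
    (fun _ => mp_flipc 1 m)

lemma colv_flipCol_self (m : Fin d) (X : Fin n → Fin d → ℝ) :
    colv (flipCol m X) m = - colv X m := by
  ext i; simp [colv, flipCol, flipc]

lemma colv_flipCol_ne {m l : Fin d} (h : l ≠ m) (X : Fin n → Fin d → ℝ) :
    colv (flipCol m X) l = colv X l := by
  ext i; simp [colv, flipCol, flipc, h]

lemma Amat_flipCol (a : Fin d → ℝ) (m : Fin d) (X : Fin n → Fin d → ℝ) :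
    Amat a (flipCol m X) = Amat a X := by
  unfold Amat
  congr 1
  refine Finset.sum_congr rfl fun l _ => ?_
  by_cases h : l = m
  · subst h
    rw [colv_flipCol_self, neg_vecMulVec, vecMulVec_neg, neg_neg]
  · rw [colv_flipCol_ne h]

lemma continuous_colv (k : Fin d) : Continuous fun X : Fin n → Fin d → ℝ => colv X k := by
  unfold colv; fun_prop

lemma continuous_Ainv {a : Fin d → ℝ} (ha : ∀ k, 0 ≤ a k) :
    Continuous fun X : Fin n → Fin d → ℝ => (Amat a X)⁻¹ := by
  have h1 : Continuous fun X : Fin n → Fin d → ℝ => Amat a X := by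
    unfold Amat
    refine continuous_const.add (continuous_finsetSum _ fun k _ => ?_)
    have h2 : Continuous fun X : Fin n → Fin d → ℝ => vecMulVec (colv X k) (colv X k) :=
      (continuous_colv k).matrix_vecMulVec (continuous_colv k)
    exact h2.const_smul (a k)
  simp only [Matrix.inv_def, Ring.inverse_eq_inv']
  exact (h1.matrix_det.inv₀ fun X => (geOne_Amat ha X).isUnit_det.ne_zero).smul h1.matrix_adjugate

lemma continuous_form {a : Fin d → ℝ} (ha : ∀ k, 0 ≤ a k) {α : Type*} [TopologicalSpace α]
    {X : α → Fin n → Fin d → ℝ} (hX : Continuous X) {x y : α → Fin n → ℝ}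
    (hx : Continuous x) (hy : Continuous y) :
    Continuous fun ω => x ω ⬝ᵥ ((Amat a (X ω))⁻¹ *ᵥ y ω) :=
  hx.dotProduct (((continuous_Ainv ha).comp hX).matrix_mulVec hy)

lemma continuous_tr {a : Fin d → ℝ} (ha : ∀ k, 0 ≤ a k) :
    Continuous fun X : Fin n → Fin d → ℝ => ((Amat a X)⁻¹).trace :=
  (continuous_Ainv ha).matrix_trace

lemma continuous_qk {a : Fin d → ℝ} (ha : ∀ k, 0 ≤ a k) (k : Fin d) :
    Continuous fun X : Fin n → Fin d → ℝ => qk a X k :=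
  continuous_form (update_nonneg ha k) continuous_id (continuous_colv k) (continuous_colv k)

lemma qk_loo {a : Fin d → ℝ} (ha : ∀ k, 0 ≤ a k) (k : Fin d) :
    ∫⁻ X, ENNReal.ofReal ((qk a X k - ((Amat (Function.update a k 0) X)⁻¹).trace) ^ 2)
      ∂(gmat n d) ≤ ENNReal.ofReal (Kq 1 * n) := by
  have hm : Measurable fun X : Fin n → Fin d → ℝ =>
      ENNReal.ofReal ((qk a X k - ((Amat (Function.update a k 0) X)⁻¹).trace) ^ 2) :=
    (((continuous_qk ha k).sub (continuous_tr (update_nonneg ha k))).pow 2).measurable.ennreal_ofReal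
  rw [lintegral_setCol k hm]
  calc _ ≤ ∫⁻ _X, ENNReal.ofReal (Kq 1 * n) ∂(gmat n d) := by
        refine lintegral_mono fun X => ?_
        simp only [qk, colv_setCol_self, Amat_setCol]
        have h := quad_form 1 ((Amat (Function.update a k 0) X)⁻¹)
        simp only [NNReal.coe_one, one_mul] at h
        refine h.trans (ENNReal.ofReal_le_ofReal ?_)
        exact mul_le_mul_of_nonneg_left (geOne_Amat (update_nonneg ha k) X).sum_sq_le (Kq_nonneg 1)
    _ = _ := by simp

lemma qk_tr {a : Fin d → ℝ} (ha : ∀ k, 0 ≤ a k) (hn : 0 < n) (k : Fin d) :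
    ∫⁻ X, ENNReal.ofReal ((qk a X k - ((Amat a X)⁻¹).trace) ^ 2)
      ∂(gmat n d) ≤ ENNReal.ofReal ((2 * Kq 1 + 2) * n) := by
  have hn1 : (1 : ℝ) ≤ n := by exact_mod_cast hn
  calc _ ≤ ∫⁻ X, (ENNReal.ofReal 2 * ENNReal.ofReal
          ((qk a X k - ((Amat (Function.update a k 0) X)⁻¹).trace) ^ 2) + ENNReal.ofReal 2)
          ∂(gmat n d) := by
        refine lintegral_mono fun X => ?_
        rw [← ENNReal.ofReal_mul (by positivity), ← ENNReal.ofReal_add (by positivity)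
          (by positivity)]
        refine ENNReal.ofReal_le_ofReal ?_
        have h := abs_le.mp (trace_diff_le ha X k)
        have h2 : (((Amat (Function.update a k 0) X)⁻¹).trace - ((Amat a X)⁻¹).trace) ^ 2 ≤ 1 := by
          nlinarith
        nlinarith [sq_nonneg ((qk a X k - ((Amat (Function.update a k 0) X)⁻¹).trace) -
          (((Amat (Function.update a k 0) X)⁻¹).trace - ((Amat a X)⁻¹).trace))]
    _ ≤ ENNReal.ofReal 2 * ENNReal.ofReal (Kq 1 * n) + ENNReal.ofReal 2 := by
        rw [lintegral_add_right _ measurable_const, lintegral_const_mul' _ _ (by simp)]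
        simp only [lintegral_const, measure_univ, mul_one]
        gcongr
        exact qk_loo ha k
    _ ≤ _ := by
        have := Kq_nonneg 1
        rw [← ENNReal.ofReal_mul (by positivity), ← ENNReal.ofReal_add (by positivity)
          (by positivity)]
        refine ENNReal.ofReal_le_ofReal ?_
        nlinarith

lemma lintegral_col_sq (l : Fin d) :
    ∫⁻ X, ENNReal.ofReal (colv X l ⬝ᵥ colv X l) ∂(gmat n d) = ENNReal.ofReal n := by
  have h1 : ∀ X : Fin n → Fin d → ℝ, ENNReal.ofReal (colv X l ⬝ᵥ colv X l) =
      ∑ i, ENNReal.ofReal (X i l ^ 2) := by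
    intro X
    rw [dotProduct, ENNReal.ofReal_sum_of_nonneg fun i _ => mul_self_nonneg _]
    simp [colv, sq]
  simp_rw [h1]
  rw [lintegral_finsetSum _ fun i _ => by fun_prop]
  have h2 : ∀ i : Fin n, ∫⁻ X, ENNReal.ofReal (X i l ^ 2) ∂(gmat n d) = 1 := by
    intro i
    have e1 := (measurePreserving_eval (fun _ : Fin n => gvec d 1) i).lintegral_comp
      (f := fun x => ENNReal.ofReal (x l ^ 2)) (by fun_prop)
    simp only [Function.eval] at e1
    rw [e1, ← ofReal_integral_eq_lintegral_ofReal (integrable_pow_coord 1 2 l)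
      (ae_of_all _ fun x => sq_nonneg _), integral_sq_coord]
    simp
  simp [h2]

lemma off_entry {a : Fin d → ℝ} (ha : ∀ k, 0 ≤ a k) {k l : Fin d} (hkl : k ≠ l) :
    ∫⁻ X, ENNReal.ofReal ((colv X l ⬝ᵥ ((Amat a X)⁻¹ *ᵥ colv X k)) ^ 2) ∂(gmat n d) ≤
      ENNReal.ofReal (2 * n) := by
  have hm : Measurable fun X : Fin n → Fin d → ℝ => ENNReal.ofReal
      ((colv X l ⬝ᵥ ((Amat (Function.update a k 0) X)⁻¹ *ᵥ colv X k)) ^ 2) :=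
    ((continuous_form (update_nonneg ha k) continuous_id (continuous_colv l)
      (continuous_colv k)).pow 2).measurable.ennreal_ofReal
  calc _ ≤ ∫⁻ X, ENNReal.ofReal
          ((colv X l ⬝ᵥ ((Amat (Function.update a k 0) X)⁻¹ *ᵥ colv X k)) ^ 2) ∂(gmat n d) :=
        lintegral_mono fun X => ENNReal.ofReal_le_ofReal (sq_dot_le ha X k l)
    _ ≤ ∫⁻ X, ENNReal.ofReal 2 * ENNReal.ofReal (colv X l ⬝ᵥ colv X l) ∂(gmat n d) := by
        rw [lintegral_setCol k hm]
        refine lintegral_mono fun X => ?_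
        have hg := geOne_Amat (update_nonneg ha k) X
        simp only [colv_setCol_self, Amat_setCol, colv_setCol_ne hkl.symm]
        simp_rw [hg.inv_dot_comm (colv X l), dotProduct_comm _ (_ *ᵥ colv X l)]
        refine (lin_form 1 _).trans ?_
        rw [← ENNReal.ofReal_mul (by positivity)]
        refine ENNReal.ofReal_le_ofReal ?_
        have := hg.norm_le (colv X l)
        simp only [NNReal.coe_one]
        linarith
    _ = _ := by
        rw [lintegral_const_mul' _ _ (by simp), lintegral_col_sq,
          ← ENNReal.ofReal_mul (by positivity)]

/-- off diagonal sum -/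
def offSum (a θ : Fin d → ℝ) (X : Fin n → Fin d → ℝ) : ℝ :=
  ∑ p : Fin d × Fin d, if p.1 = p.2 then 0 else
    θ p.1 * θ p.2 * (colv X p.1 ⬝ᵥ ((Amat a X)⁻¹ *ᵥ colv X p.2))

lemma continuous_offSum {a : Fin d → ℝ} (ha : ∀ k, 0 ≤ a k) (θ : Fin d → ℝ) :
    Continuous fun X : Fin n → Fin d → ℝ => offSum a θ X := by
  unfold offSum
  refine continuous_finsetSum _ fun p _ => ?_
  by_cases h : p.1 = p.2
  · simp only [h, if_true]; exact continuous_const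
  · simp only [h, if_false]
    exact continuous_const.mul
      (continuous_form ha continuous_id (continuous_colv _) (continuous_colv _))

lemma off_sum_le {a : Fin d → ℝ} (ha : ∀ k, 0 ≤ a k) (θ : Fin d → ℝ) {B : ℝ}
    (hB : ∀ k, |θ k| ≤ B) :
    ∫⁻ X, ENNReal.ofReal ((offSum a θ X) ^ 2) ∂(gmat n d) ≤
      ENNReal.ofReal (4 * B ^ 4 * n * d ^ 2) := by
  let f : Fin d × Fin d → (Fin n → Fin d → ℝ) → ℝ := fun p X => if p.1 = p.2 then 0 else
    θ p.1 * θ p.2 * (colv X p.1 ⬝ᵥ ((Amat a X)⁻¹ *ᵥ colv X p.2))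
  have hfc : ∀ p, Measurable (f p) := by
    intro p
    simp only [f]
    by_cases h : p.1 = p.2
    · simp only [h, if_true]; exact measurable_const
    · simp only [h, if_false]
      exact (continuous_const.mul
        (continuous_form ha continuous_id (continuous_colv _) (continuous_colv _))).measurable
  have hent : ∀ p, ∫⁻ X, ENNReal.ofReal ((f p X) ^ 2) ∂(gmat n d) ≤
      ENNReal.ofReal (B ^ 4 * (2 * n)) := by
    intro p
    simp only [f]
    by_cases h : p.1 = p.2
    · simp [h]
    · simp only [h, if_false]
      have hB2 : (θ p.1 * θ p.2) ^ 2 ≤ B ^ 4 := by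
        have h1 : |θ p.1 * θ p.2| ≤ B * B := by
          rw [abs_mul]
          exact mul_le_mul (hB _) (hB _) (abs_nonneg _) ((abs_nonneg _).trans (hB p.1))
        calc (θ p.1 * θ p.2) ^ 2 = |θ p.1 * θ p.2| ^ 2 := (sq_abs _).symm
          _ ≤ (B * B) ^ 2 := by gcongr
          _ = B ^ 4 := by ring
      calc _ ≤ ∫⁻ X, ENNReal.ofReal (B ^ 4) * ENNReal.ofReal
            ((colv X p.1 ⬝ᵥ ((Amat a X)⁻¹ *ᵥ colv X p.2)) ^ 2) ∂(gmat n d) := by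
              refine lintegral_mono fun X => ?_
              rw [← ENNReal.ofReal_mul (by positivity), mul_pow]
              refine ENNReal.ofReal_le_ofReal ?_
              exact mul_le_mul_of_nonneg_right hB2 (sq_nonneg _)
        _ ≤ ENNReal.ofReal (B ^ 4) * ENNReal.ofReal (2 * n) := by
              rw [lintegral_const_mul' _ _ (by simp)]
              gcongr
              exact off_entry ha (Ne.symm h)
        _ = _ := by rw [← ENNReal.ofReal_mul (by positivity)]
  have hintg : ∀ p, Integrable (fun X => (f p X) ^ 2) (gmat n d) := by
    intro p
    refine ⟨((hfc p).pow_const 2).aestronglyMeasurable, ?_⟩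
    rw [hasFiniteIntegral_iff_ofReal (ae_of_all _ fun x => sq_nonneg _)]
    exact (hent p).trans_lt ENNReal.ofReal_lt_top
  have hl : ∀ p, MemLp (f p) 2 (gmat n d) := fun p =>
    (memLp_two_iff_integrable_sq (hfc p).aestronglyMeasurable).2 (hintg p)
  have hB4 : 0 ≤ B ^ 4 * (2 * (n : ℝ)) := by positivity
  have hval : ∀ p, ∫ X, (f p X) ^ 2 ∂(gmat n d) ≤ B ^ 4 * (2 * n) := by
    intro p
    have h := hent p
    rw [← ofReal_integral_eq_lintegral_ofReal (hintg p) (ae_of_all _ fun x => sq_nonneg _)] at h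
    exact (ENNReal.ofReal_le_ofReal_iff hB4).1 h
  have h := lintegral_sum_sq_le (gmat n d) f Prod.swap (fun _ => rfl) hl ?_
  · refine h.trans (ENNReal.ofReal_le_ofReal ?_)
    calc 2 * ∑ p, ∫ X, (f p X) ^ 2 ∂(gmat n d) ≤ 2 * ∑ _p : Fin d × Fin d, B ^ 4 * (2 * (n : ℝ)) := by
          gcongr with p; exact hval p
      _ = 4 * B ^ 4 * n * d ^ 2 := by
          simp only [Finset.sum_const, Finset.card_univ, Fintype.card_prod, Fintype.card_fin,
            nsmul_eq_mul]
          push_cast; ring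
  · intro p q hpq hpq'
    have hmeas : Measurable fun X => f p X * f q X := (hfc p).mul (hfc q)
    obtain ⟨i, j⟩ := p
    obtain ⟨k, l⟩ := q
    simp only [ne_eq, Prod.mk.injEq, Prod.swap_prod_mk, not_and] at hpq hpq'
    by_cases hij : i = j
    · simp [f, hij]
    by_cases hkl : k = l
    · simp [f, hkl]
    by_cases h : i = k ∨ i = l
    · have hj : j ≠ k ∧ j ≠ l := by
        constructor
        · rintro rfl
          rcases h with h | h
          · exact hij h
          · exact hpq' rfl h.symm
        · rintro rfl
          rcases h with h | h
          · exact hpq h.symm rfl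
          · exact hij h
      refine integral_eq_zero_of_flip (mp_flipCol j) hmeas fun X => ?_
      simp only [f, hij, hkl, if_false, Amat_flipCol, colv_flipCol_self, colv_flipCol_ne hij,
        colv_flipCol_ne hj.1.symm, colv_flipCol_ne hj.2.symm, mulVec_neg, dotProduct_neg]
      ring
    · push Not at h
      have h3 : j ≠ i := fun h' => hij h'.symm
      refine integral_eq_zero_of_flip (mp_flipCol i) hmeas fun X => ?_
      simp only [f, hij, hkl, if_false, Amat_flipCol, colv_flipCol_self, colv_flipCol_ne h3,
        colv_flipCol_ne h.1.symm, colv_flipCol_ne h.2.symm, neg_dotProduct]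
      ring

end rmt

/-! ### Finite-dimensional estimate -/

section fin

open Matrix

variable {n d : ℕ}

lemma frac_lip {c t s : ℝ} (hc : 0 ≤ c) (ht : 0 ≤ t) (hs : 0 ≤ s) :
    |t / (1 + c * t) - s / (1 + c * s)| ≤ |t - s| := by
  have h1 : 1 ≤ 1 + c * t := by have := mul_nonneg hc ht; linarith
  have h2 : 1 ≤ 1 + c * s := by have := mul_nonneg hc hs; linarith
  have h3 : t / (1 + c * t) - s / (1 + c * s) = (t - s) / ((1 + c * t) * (1 + c * s)) := by
    field_simp; ring
  rw [h3, abs_div, abs_of_pos (by positivity : 0 < (1 + c * t) * (1 + c * s))]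
  exact div_le_self (abs_nonneg _) (by nlinarith)

/-- empirical version of the limiting value -/
def Gd (σ2 : ℝ) (c θ : Fin d → ℝ) (δ : ℝ) : ℝ :=
  σ2 * δ + (1 / (d : ℝ)) * ∑ k, θ k ^ 2 * (δ / (1 + c k * δ))

/-- empirical version of the fixed point equation -/
def Hd (κ : ℝ) (c : Fin d → ℝ) (δ : ℝ) : ℝ :=
  δ + κ * ((1 / (d : ℝ)) * ∑ k, c k * (δ / (1 + c k * δ)))

lemma Hd_expand {κ : ℝ} (hκ : 0 ≤ κ) {c : Fin d → ℝ} (hc : ∀ k, 0 ≤ c k) {δ δs : ℝ} (h : 0 ≤ δ)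
    (hs : 0 ≤ δs) : |δ - δs| ≤ |Hd κ c δ - Hd κ c δs| := by
  have key : ∀ x y : ℝ, 0 ≤ x → 0 ≤ y → x ≤ y → y - x ≤ Hd κ c y - Hd κ c x := by
    intro x y hx hy hxy
    have h1 : ∑ k, c k * (x / (1 + c k * x)) ≤ ∑ k, c k * (y / (1 + c k * y)) := by
      refine Finset.sum_le_sum fun k _ => mul_le_mul_of_nonneg_left ?_ (hc k)
      have h1 : 0 < 1 + c k * x := by have := mul_nonneg (hc k) hx; linarith
      have h2 : 0 < 1 + c k * y := by have := mul_nonneg (hc k) hy; linarith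
      rw [div_le_div_iff₀ h1 h2]; nlinarith
    unfold Hd
    have h2 := mul_le_mul_of_nonneg_left (mul_le_mul_of_nonneg_left h1
      (by positivity : (0 : ℝ) ≤ 1 / (d : ℝ))) hκ
    linarith
  rcases le_total δ δs with hle | hle
  · have := key δ δs h hs hle
    rw [abs_sub_comm, abs_sub_comm (Hd κ c δ), abs_of_nonneg (by linarith)]
    exact this.trans (le_abs_self _)
  · have := key δs δ hs h hle
    rw [abs_of_nonneg (by linarith)]
    exact this.trans (le_abs_self _)

lemma Gd_lip {σ2 B : ℝ} (hσ : 0 ≤ σ2) {c θ : Fin d → ℝ} (hc : ∀ k, 0 ≤ c k)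
    (hB : ∀ k, θ k ^ 2 ≤ B ^ 2) (hd : 0 < d) {δ δs : ℝ} (h : 0 ≤ δ) (hs : 0 ≤ δs) :
    |Gd σ2 c θ δ - Gd σ2 c θ δs| ≤ (σ2 + B ^ 2) * |δ - δs| := by
  have hd' : (0 : ℝ) < d := by exact_mod_cast hd
  have e : Gd σ2 c θ δ - Gd σ2 c θ δs = σ2 * (δ - δs) + (1 / (d : ℝ)) *
      ∑ k, θ k ^ 2 * (δ / (1 + c k * δ) - δs / (1 + c k * δs)) := by
    unfold Gd
    simp only [mul_sub, Finset.sum_sub_distrib]; ring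
  rw [e]
  have h2 : |∑ k, θ k ^ 2 * (δ / (1 + c k * δ) - δs / (1 + c k * δs))| ≤ d * (B ^ 2 * |δ - δs|) := by
    refine (Finset.abs_sum_le_sum_abs _ _).trans ?_
    calc _ ≤ ∑ _k : Fin d, B ^ 2 * |δ - δs| := by
          refine Finset.sum_le_sum fun k _ => ?_
          rw [abs_mul, abs_of_nonneg (sq_nonneg (θ k))]
          exact mul_le_mul (hB k) (frac_lip (hc k) h hs) (abs_nonneg _) (sq_nonneg _)
      _ = _ := by simp
  refine (abs_add_le _ _).trans ?_
  rw [abs_mul, abs_mul, abs_of_nonneg hσ, abs_of_nonneg (by positivity : (0 : ℝ) ≤ 1 / d)]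
  have h3 := mul_le_mul_of_nonneg_left h2 (by positivity : (0 : ℝ) ≤ 1 / (d : ℝ))
  have h4 : 1 / (d : ℝ) * (d * (B ^ 2 * |δ - δs|)) = B ^ 2 * |δ - δs| := by field_simp
  linarith

/-- signal part -/
def zvec (θ : Fin d → ℝ) (X : Fin n → Fin d → ℝ) : Fin n → ℝ :=
  ∑ k, (θ k / Real.sqrt d) • colv X k

lemma zvec_apply (θ : Fin d → ℝ) (X : Fin n → Fin d → ℝ) (i : Fin n) :
    zvec θ X i = (fun k => θ k / Real.sqrt d) ⬝ᵥ (X i) := by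
  simp [zvec, colv, dotProduct]

lemma continuous_zvec (θ : Fin d → ℝ) : Continuous fun X : Fin n → Fin d → ℝ => zvec θ X := by
  unfold zvec
  refine continuous_finsetSum _ fun k _ => ?_
  have h2 : Continuous fun X : Fin n → Fin d → ℝ => colv X k := continuous_colv k
  exact h2.const_smul (θ k / Real.sqrt d)

lemma zvec_form (θ : Fin d → ℝ) (X : Fin n → Fin d → ℝ) (a : Fin d → ℝ) :
    zvec θ X ⬝ᵥ ((Amat a X)⁻¹ *ᵥ zvec θ X) = (1 / (d : ℝ)) * (offSum a θ X +
      ∑ k, θ k ^ 2 * (colv X k ⬝ᵥ ((Amat a X)⁻¹ *ᵥ colv X k))) := by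
  have hs : Real.sqrt d * Real.sqrt d = d := Real.mul_self_sqrt (by positivity)
  have e1 : zvec θ X ⬝ᵥ ((Amat a X)⁻¹ *ᵥ zvec θ X) = ∑ p : Fin d × Fin d, (1 / (d : ℝ)) *
      (θ p.1 * θ p.2 * (colv X p.1 ⬝ᵥ ((Amat a X)⁻¹ *ᵥ colv X p.2))) := by
    rw [Fintype.sum_prod_type]
    unfold zvec
    rw [sum_dotProduct]
    refine Finset.sum_congr rfl fun k _ => ?_
    rw [mulVec_sum, dotProduct_sum]
    refine Finset.sum_congr rfl fun l _ => ?_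
    rw [mulVec_smul, dotProduct_smul, smul_dotProduct, smul_eq_mul, smul_eq_mul]
    conv_rhs => rw [← hs]
    ring
  rw [e1, ← Finset.mul_sum]
  congr 1
  have e2 : ∑ k, θ k ^ 2 * (colv X k ⬝ᵥ ((Amat a X)⁻¹ *ᵥ colv X k)) =
      ∑ p : Fin d × Fin d, if p.1 = p.2 then
        θ p.1 * θ p.2 * (colv X p.1 ⬝ᵥ ((Amat a X)⁻¹ *ᵥ colv X p.2)) else 0 := by
    rw [Fintype.sum_prod_type]
    refine Finset.sum_congr rfl fun k _ => ?_
    simp [sq]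
  rw [e2, offSum, ← Finset.sum_add_distrib]
  refine Finset.sum_congr rfl fun p _ => ?_
  split_ifs <;> simp

/-- random error -/
def errT (σ2 : ℝ) (a θ w : Fin d → ℝ) (ω : (Fin n → Fin d → ℝ) × (Fin n → ℝ)) : ℝ :=
  (1 / (n : ℝ)) * (|ω.2 ⬝ᵥ ((Amat a ω.1)⁻¹ *ᵥ ω.2) - σ2 * ((Amat a ω.1)⁻¹).trace| +
    2 * |((Amat a ω.1)⁻¹ *ᵥ zvec θ ω.1) ⬝ᵥ ω.2| + |(1 / (d : ℝ)) * offSum a θ ω.1| +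
    ∑ k, w k * |qk a ω.1 k - ((Amat a ω.1)⁻¹).trace|)

lemma det_bound {σ2 B κ : ℝ} (hσ : 0 ≤ σ2) (hn : 0 < n) (hd : 0 < d) (hκ : κ = d / n)
    {c θ a : Fin d → ℝ} (hc : ∀ k, 0 ≤ c k) (ha : ∀ k, a k = c k / n)
    (hB : ∀ k, θ k ^ 2 ≤ B ^ 2) {δs : ℝ} (hs : 0 ≤ δs)
    (ω : (Fin n → Fin d → ℝ) × (Fin n → ℝ)) :
    |(1 / (n : ℝ)) * ((zvec θ ω.1 + ω.2) ⬝ᵥ ((Amat a ω.1)⁻¹ *ᵥ (zvec θ ω.1 + ω.2))) - Gd σ2 c θ δs|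
      ≤ errT σ2 a θ (fun k => (1 / (d : ℝ)) * (B ^ 2 + (σ2 + B ^ 2) * κ * c k)) ω +
        (σ2 + B ^ 2) * |Hd κ c δs - 1| := by
  obtain ⟨X, ε⟩ := ω
  simp only
  have hn' : (0 : ℝ) < n := by exact_mod_cast hn
  have hd' : (0 : ℝ) < d := by exact_mod_cast hd
  have hκ0 : 0 ≤ κ := by rw [hκ]; positivity
  have ha0 : ∀ k, 0 ≤ a k := fun k => by rw [ha]; exact div_nonneg (hc k) hn'.le
  have hg := geOne_Amat ha0 X
  set Q := (Amat a X)⁻¹ with hQ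
  set z := zvec θ X with hz
  set δ := Q.trace / n with hδ
  have hδ0 : 0 ≤ δ := div_nonneg hg.trace_nonneg hn'.le
  let t : Fin d → ℝ := fun k => qk a X k / n
  have ht0 : ∀ k, 0 ≤ t k := fun k => div_nonneg (qk_nonneg ha0 X k) hn'.le
  have hdiag : ∀ k, colv X k ⬝ᵥ (Q *ᵥ colv X k) = n * (t k / (1 + c k * t k)) := by
    intro k
    rw [hQ, dot_self_eq ha0 X k]
    have : a k * qk a X k = c k * t k := by simp only [t]; rw [ha]; ring
    rw [this]; simp only [t]; field_simp
  -- fixed point equation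
  have hfix : δ + κ * ((1 / (d : ℝ)) * ∑ k, c k * (t k / (1 + c k * t k))) = 1 := by
    have h := trace_identity ha0 X
    rw [← hQ] at h
    have h2 : ∑ k, a k * (colv X k ⬝ᵥ (Q *ᵥ colv X k)) = ∑ k, c k * (t k / (1 + c k * t k)) := by
      refine Finset.sum_congr rfl fun k _ => ?_
      rw [hdiag, ha]; field_simp
    rw [h2] at h
    rw [hκ, hδ]
    generalize ∑ k, c k * (t k / (1 + c k * t k)) = S at h ⊢
    field_simp
    linarith
  have hlip : ∀ k, |t k / (1 + c k * t k) - δ / (1 + c k * δ)| ≤ |t k - δ| := fun k =>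
    frac_lip (hc k) (ht0 k) hδ0
  have hH : |Hd κ c δ - 1| ≤ κ * ((1 / (d : ℝ)) * ∑ k, c k * |t k - δ|) := by
    have e : Hd κ c δ - 1 = κ * ((1 / (d : ℝ)) *
        ∑ k, c k * (δ / (1 + c k * δ) - t k / (1 + c k * t k))) := by
      conv_lhs => rw [← hfix]
      unfold Hd
      simp only [mul_sub, Finset.sum_sub_distrib]; ring
    rw [e, abs_mul, abs_mul, abs_of_nonneg hκ0, abs_of_nonneg (by positivity : (0 : ℝ) ≤ 1 / d)]
    gcongr
    refine (Finset.abs_sum_le_sum_abs _ _).trans (Finset.sum_le_sum fun k _ => ?_)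
    rw [abs_mul, abs_of_nonneg (hc k), abs_sub_comm]
    exact mul_le_mul_of_nonneg_left (hlip k) (hc k)
  have hδs : |δ - δs| ≤ κ * ((1 / (d : ℝ)) * ∑ k, c k * |t k - δ|) + |Hd κ c δs - 1| := by
    refine (Hd_expand hκ0 hc hδ0 hs).trans ?_
    have : Hd κ c δ - Hd κ c δs = (Hd κ c δ - 1) - (Hd κ c δs - 1) := by ring
    rw [this]
    refine (abs_sub _ _).trans ?_
    linarith
  have hG := Gd_lip hσ hc hB hd hδ0 hs
  have hD : |(1 / (d : ℝ)) * ∑ k, θ k ^ 2 * (t k / (1 + c k * t k) - δ / (1 + c k * δ))| ≤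
      (1 / (d : ℝ)) * ∑ k, B ^ 2 * |t k - δ| := by
    rw [abs_mul, abs_of_nonneg (by positivity : (0 : ℝ) ≤ 1 / d)]
    gcongr
    refine (Finset.abs_sum_le_sum_abs _ _).trans (Finset.sum_le_sum fun k _ => ?_)
    rw [abs_mul, abs_of_nonneg (sq_nonneg (θ k))]
    exact mul_le_mul (hB k) (hlip k) (abs_nonneg _) (sq_nonneg _)
  have hexp : (z + ε) ⬝ᵥ (Q *ᵥ (z + ε)) = ε ⬝ᵥ (Q *ᵥ ε) + 2 * ((Q *ᵥ z) ⬝ᵥ ε) +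
      (1 / (d : ℝ)) * (offSum a θ X + ∑ k, θ k ^ 2 * (n * (t k / (1 + c k * t k)))) := by
    have h1 := zvec_form θ X a
    rw [← hQ, ← hz] at h1
    simp only [hdiag] at h1
    rw [mulVec_add, add_dotProduct, dotProduct_add, dotProduct_add, h1,
      show z ⬝ᵥ (Q *ᵥ ε) = ε ⬝ᵥ (Q *ᵥ z) from hg.inv_dot_comm z ε, dotProduct_comm (Q *ᵥ z) ε]
    ring
  have hdec : (1 / (n : ℝ)) * ((z + ε) ⬝ᵥ (Q *ᵥ (z + ε))) - Gd σ2 c θ δs =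
      (1 / (n : ℝ)) * (ε ⬝ᵥ (Q *ᵥ ε) - σ2 * Q.trace) + (1 / (n : ℝ)) * (2 * ((Q *ᵥ z) ⬝ᵥ ε))
      + (1 / (n : ℝ)) * ((1 / (d : ℝ)) * offSum a θ X)
      + (1 / (d : ℝ)) * ∑ k, θ k ^ 2 * (t k / (1 + c k * t k) - δ / (1 + c k * δ))
      + (Gd σ2 c θ δ - Gd σ2 c θ δs) := by
    rw [hexp]
    have e1 : Gd σ2 c θ δ = σ2 * (Q.trace / n) + (1 / (d : ℝ)) * ∑ k, θ k ^ 2 * (δ / (1 + c k * δ)) := rfl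
    have e2 : ∑ k, θ k ^ 2 * ((n : ℝ) * (t k / (1 + c k * t k))) =
        (n : ℝ) * ∑ k, θ k ^ 2 * (t k / (1 + c k * t k)) := by
      rw [Finset.mul_sum]
      refine Finset.sum_congr rfl fun k _ => ?_
      ring
    rw [e1, e2]
    have e3 : ∑ k, θ k ^ 2 * (t k / (1 + c k * t k) - δ / (1 + c k * δ)) =
        ∑ k, θ k ^ 2 * (t k / (1 + c k * t k)) - ∑ k, θ k ^ 2 * (δ / (1 + c k * δ)) := by
      simp only [mul_sub, Finset.sum_sub_distrib]
    rw [e3]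
    generalize ∑ k, θ k ^ 2 * (t k / (1 + c k * t k)) = S1
    generalize ∑ k, θ k ^ 2 * (δ / (1 + c k * δ)) = S2
    field_simp
    ring
  have hw : (1 / (n : ℝ)) * ∑ k, (1 / (d : ℝ)) * (B ^ 2 + (σ2 + B ^ 2) * κ * c k) *
      |qk a X k - Q.trace| = (1 / (d : ℝ)) * ∑ k, B ^ 2 * |t k - δ| +
      (σ2 + B ^ 2) * (κ * ((1 / (d : ℝ)) * ∑ k, c k * |t k - δ|)) := by
    simp only [Finset.mul_sum]
    rw [← Finset.sum_add_distrib]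
    refine Finset.sum_congr rfl fun k _ => ?_
    have : |t k - δ| = (1 / n) * |qk a X k - Q.trace| := by
      have : t k - δ = (1 / n) * (qk a X k - Q.trace) := by simp only [t, hδ]; ring
      rw [this, abs_mul, abs_of_nonneg (by positivity : (0 : ℝ) ≤ 1 / n)]
    rw [this]; ring
  unfold errT
  simp only [← hQ, ← hz]
  rw [mul_add, hw, hdec]
  have hσB : 0 ≤ σ2 + B ^ 2 := by positivity
  have hfin := mul_le_mul_of_nonneg_left hδs hσB
  have hn1 : (0 : ℝ) ≤ 1 / n := by positivity
  have t1 : ∀ x : ℝ, |(1 / (n : ℝ)) * x| = (1 / (n : ℝ)) * |x| := fun x => by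
    rw [abs_mul, abs_of_nonneg hn1]
  have t2 : |2 * ((Q *ᵥ z) ⬝ᵥ ε)| = 2 * |(Q *ᵥ z) ⬝ᵥ ε| := by
    rw [abs_mul, abs_of_pos (by norm_num : (0 : ℝ) < 2)]
  refine (abs_add_le _ _).trans ?_
  refine (add_le_add_left (abs_add_le _ _) _).trans ?_
  refine (add_le_add_left (add_le_add_left (abs_add_le _ _) _) _).trans ?_
  refine (add_le_add_left (add_le_add_left (add_le_add_left (abs_add_le _ _) _) _) _).trans ?_
  rw [t1, t1, t1, t2]
  linarith

/-! second moments on the product space -/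

lemma zvec_sq (θ : Fin d → ℝ) {B : ℝ} (hB : ∀ k, θ k ^ 2 ≤ B ^ 2) (hd : 0 < d) :
    ∫⁻ X, ENNReal.ofReal (zvec θ X ⬝ᵥ zvec θ X) ∂(gmat n d) ≤ ENNReal.ofReal (2 * B ^ 2 * n) := by
  have hd' : (0 : ℝ) < d := by exact_mod_cast hd
  have h1 : ∀ X : Fin n → Fin d → ℝ, ENNReal.ofReal (zvec θ X ⬝ᵥ zvec θ X) =
      ∑ i, ENNReal.ofReal (((fun k => θ k / Real.sqrt d) ⬝ᵥ (X i)) ^ 2) := by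
    intro X
    rw [dotProduct, ENNReal.ofReal_sum_of_nonneg fun i _ => mul_self_nonneg _]
    simp [zvec_apply, sq]
  simp_rw [h1]
  have hm : Measurable fun x : Fin d → ℝ =>
      ENNReal.ofReal (((fun k => θ k / Real.sqrt d) ⬝ᵥ x) ^ 2) :=
    ((continuous_const.dotProduct continuous_id).pow 2).measurable.ennreal_ofReal
  rw [lintegral_finsetSum _ fun i _ => (show Measurable fun X : Fin n → Fin d → ℝ =>
    ENNReal.ofReal (((fun k => θ k / Real.sqrt d) ⬝ᵥ X i) ^ 2) from
      hm.comp (measurable_pi_apply i))]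
  have h2 : ∀ i : Fin n, ∫⁻ X : Fin n → Fin d → ℝ,
      ENNReal.ofReal (((fun k => θ k / Real.sqrt d) ⬝ᵥ (X i)) ^ 2) ∂(gmat n d) ≤
        ENNReal.ofReal (2 * B ^ 2) := by
    intro i
    have e1 := (measurePreserving_eval (fun _ : Fin n => gvec d 1) i).lintegral_comp hm
    simp only [Function.eval] at e1
    rw [e1]
    refine (lin_form 1 _).trans (ENNReal.ofReal_le_ofReal ?_)
    have : ((fun k => θ k / Real.sqrt d) ⬝ᵥ fun k => θ k / Real.sqrt d) ≤ B ^ 2 := by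
      simp only [dotProduct]
      calc _ ≤ ∑ _k : Fin d, B ^ 2 / d := by
            refine Finset.sum_le_sum fun k _ => ?_
            rw [div_mul_div_comm, Real.mul_self_sqrt hd'.le, ← sq]
            exact div_le_div_of_nonneg_right (hB k) hd'.le
        _ = B ^ 2 := by simp; field_simp
    simp only [NNReal.coe_one]
    linarith
  calc _ ≤ ∑ _i : Fin n, ENNReal.ofReal (2 * B ^ 2) := Finset.sum_le_sum fun i _ => h2 i
    _ = _ := by
      rw [mul_comm (2 * B ^ 2), ENNReal.ofReal_mul (by positivity)]
      simp

lemma combine_bound {Ω : Type*} [MeasurableSpace Ω] (μ : Measure Ω) {f1 f2 f3 : Ω → ℝ}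
    {f4 : Fin d → Ω → ℝ} (m1 : Measurable f1) (m2 : Measurable f2) (m3 : Measurable f3)
    (m4 : ∀ k, Measurable (f4 k)) {r : ℝ} (hr : 0 ≤ r)
    (b1 : ∫⁻ ω, ENNReal.ofReal |f1 ω| ∂μ ≤ ENNReal.ofReal r)
    (b2 : ∫⁻ ω, ENNReal.ofReal |f2 ω| ∂μ ≤ ENNReal.ofReal r)
    (b3 : ∫⁻ ω, ENNReal.ofReal |f3 ω| ∂μ ≤ ENNReal.ofReal r)
    (b4 : ∀ k, ∫⁻ ω, ENNReal.ofReal |f4 k ω| ∂μ ≤ ENNReal.ofReal r)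
    {w : Fin d → ℝ} (hw : ∀ k, 0 ≤ w k) {W p : ℝ} (hp : 0 ≤ p) (hW : ∑ k, w k ≤ W) :
    ∫⁻ ω, ENNReal.ofReal (p * (|f1 ω| + 2 * |f2 ω| + |f3 ω| + ∑ k, w k * |f4 k ω|)) ∂μ ≤
      ENNReal.ofReal (p * ((4 + W) * r)) := by
  have m1' := m1.abs
  have m2' := m2.abs
  have m3' := m3.abs
  have m4' := fun k => (m4 k).abs
  have h1 : ∀ ω, ENNReal.ofReal (p * (|f1 ω| + 2 * |f2 ω| + |f3 ω| + ∑ k, w k * |f4 k ω|)) =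
      ENNReal.ofReal p *
        (ENNReal.ofReal |f1 ω| + ENNReal.ofReal 2 * ENNReal.ofReal |f2 ω| + ENNReal.ofReal |f3 ω| +
          ∑ k, ENNReal.ofReal (w k) * ENNReal.ofReal |f4 k ω|) := by
    intro ω
    have hs : 0 ≤ ∑ k, w k * |f4 k ω| :=
      Finset.sum_nonneg fun k _ => mul_nonneg (hw k) (abs_nonneg _)
    rw [ENNReal.ofReal_mul hp, ENNReal.ofReal_add (by positivity) hs,
      ENNReal.ofReal_add (by positivity) (by positivity),
      ENNReal.ofReal_add (by positivity) (by positivity), ENNReal.ofReal_mul (by positivity),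
      ENNReal.ofReal_sum_of_nonneg fun k _ => mul_nonneg (hw k) (abs_nonneg _)]
    simp_rw [fun k => ENNReal.ofReal_mul (q := |f4 k ω|) (hw k)]
  simp_rw [h1]
  rw [lintegral_const_mul' _ _ (by simp), lintegral_add_left (by fun_prop),
    lintegral_add_left (by fun_prop), lintegral_add_left (by fun_prop),
    lintegral_const_mul' _ _ (by simp), lintegral_finsetSum _ fun k _ => by fun_prop]
  simp_rw [fun k => lintegral_const_mul' (μ := μ) (ENNReal.ofReal (w k))
    (fun ω => ENNReal.ofReal |f4 k ω|) (by simp)]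
  calc _ ≤ ENNReal.ofReal p * (ENNReal.ofReal r + ENNReal.ofReal 2 * ENNReal.ofReal r
        + ENNReal.ofReal r + ∑ k, ENNReal.ofReal (w k) * ENNReal.ofReal r) := by
        gcongr with k
        exact b4 k
    _ = ENNReal.ofReal (p * (r + 2 * r + r + ∑ k, w k * r)) := by
        have hs : 0 ≤ ∑ k, w k * r := Finset.sum_nonneg fun k _ => mul_nonneg (hw k) hr
        rw [ENNReal.ofReal_mul hp, ENNReal.ofReal_add (by positivity) hs,
          ENNReal.ofReal_add (by positivity) (by positivity),
          ENNReal.ofReal_add (by positivity) (by positivity), ENNReal.ofReal_mul (by positivity),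
          ENNReal.ofReal_sum_of_nonneg fun k _ => mul_nonneg (hw k) hr]
        simp_rw [fun k => ENNReal.ofReal_mul (q := r) (hw k)]
    _ ≤ _ := by
        refine ENNReal.ofReal_le_ofReal (mul_le_mul_of_nonneg_left ?_ hp)
        rw [← Finset.sum_mul]
        have := mul_le_mul_of_nonneg_right hW hr
        linarith

lemma meas_f1 (s : ℝ≥0) {a : Fin d → ℝ} (ha : ∀ k, 0 ≤ a k) :
    Measurable fun ω : (Fin n → Fin d → ℝ) × (Fin n → ℝ) =>
      ω.2 ⬝ᵥ ((Amat a ω.1)⁻¹ *ᵥ ω.2) - s * ((Amat a ω.1)⁻¹).trace :=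
  ((continuous_form ha continuous_fst continuous_snd continuous_snd).sub
    (continuous_const.mul ((continuous_tr ha).comp continuous_fst))).measurable

lemma meas_f2 (θ : Fin d → ℝ) {a : Fin d → ℝ} (ha : ∀ k, 0 ≤ a k) :
    Measurable fun ω : (Fin n → Fin d → ℝ) × (Fin n → ℝ) =>
      ((Amat a ω.1)⁻¹ *ᵥ zvec θ ω.1) ⬝ᵥ ω.2 :=
  ((((continuous_Ainv ha).comp continuous_fst).matrix_mulVec
    ((continuous_zvec θ).comp continuous_fst)).dotProduct continuous_snd).measurable

lemma meas_f3 (θ : Fin d → ℝ) {a : Fin d → ℝ} (ha : ∀ k, 0 ≤ a k) :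
    Measurable fun X : Fin n → Fin d → ℝ => (1 / (d : ℝ)) * offSum a θ X :=
  (continuous_const.mul (continuous_offSum ha θ)).measurable

lemma meas_f4 {a : Fin d → ℝ} (ha : ∀ k, 0 ≤ a k) (k : Fin d) :
    Measurable fun X : Fin n → Fin d → ℝ => qk a X k - ((Amat a X)⁻¹).trace :=
  ((continuous_qk ha k).sub (continuous_tr ha)).measurable

lemma bound_f1 (s : ℝ≥0) {a : Fin d → ℝ} (ha : ∀ k, 0 ≤ a k) {M r : ℝ} (hM0 : 0 < M)
    (hM1 : Kq s ≤ M) (hr : 0 < r) (hr2 : r ^ 2 = M * n) :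
    ∫⁻ ω, ENNReal.ofReal |ω.2 ⬝ᵥ ((Amat a ω.1)⁻¹ *ᵥ ω.2) - s * ((Amat a ω.1)⁻¹).trace|
      ∂((gmat n d).prod (gvec n s)) ≤ ENNReal.ofReal r := by
  refine lintegral_abs_le (meas_f1 s ha) hr ?_
  rw [hr2, lintegral_prod _ ((meas_f1 s ha).pow_const 2).ennreal_ofReal.aemeasurable]
  calc _ ≤ ∫⁻ _X, ENNReal.ofReal (M * n) ∂(gmat n d) := by
        refine lintegral_mono fun X => ?_
        refine (quad_form s ((Amat a X)⁻¹)).trans (ENNReal.ofReal_le_ofReal ?_)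
        exact mul_le_mul hM1 (geOne_Amat ha X).sum_sq_le (by positivity) hM0.le
    _ = _ := by simp

lemma bound_f2 (s : ℝ≥0) {B : ℝ} (hd : 0 < d) {θ a : Fin d → ℝ} (ha : ∀ k, 0 ≤ a k)
    (hB2 : ∀ k, θ k ^ 2 ≤ B ^ 2) {M r : ℝ}
    (hM2 : 4 * s * B ^ 2 ≤ M) (hr : 0 < r) (hr2 : r ^ 2 = M * n) :
    ∫⁻ ω, ENNReal.ofReal |((Amat a ω.1)⁻¹ *ᵥ zvec θ ω.1) ⬝ᵥ ω.2|
      ∂((gmat n d).prod (gvec n s)) ≤ ENNReal.ofReal r := by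
  refine lintegral_abs_le (meas_f2 θ ha) hr ?_
  rw [hr2, lintegral_prod _ ((meas_f2 θ ha).pow_const 2).ennreal_ofReal.aemeasurable]
  have hs0 : (0 : ℝ) ≤ s := s.2
  calc _ ≤ ∫⁻ X, ENNReal.ofReal (2 * s) * ENNReal.ofReal (zvec θ X ⬝ᵥ zvec θ X) ∂(gmat n d) := by
        refine lintegral_mono fun X => ?_
        have h1 := lin_form s ((Amat a X)⁻¹ *ᵥ zvec θ X)
        have h2 := (geOne_Amat ha X).norm_le (zvec θ X)
        have h3 : 2 * ((s : ℝ) * (((Amat a X)⁻¹ *ᵥ zvec θ X) ⬝ᵥ ((Amat a X)⁻¹ *ᵥ zvec θ X))) ≤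
            2 * (s : ℝ) * (zvec θ X ⬝ᵥ zvec θ X) := by
          rw [← mul_assoc]
          exact mul_le_mul_of_nonneg_left h2 (by positivity)
        have h4 := h1.trans (ENNReal.ofReal_le_ofReal h3)
        rw [ENNReal.ofReal_mul (mul_nonneg zero_le_two hs0)] at h4
        exact h4
    _ ≤ ENNReal.ofReal (2 * s) * ENNReal.ofReal (2 * B ^ 2 * n) := by
        rw [lintegral_const_mul' _ _ ENNReal.ofReal_ne_top]
        exact mul_le_mul_right (zvec_sq θ hB2 hd) _
    _ ≤ _ := by
        rw [← ENNReal.ofReal_mul (by positivity)]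
        refine ENNReal.ofReal_le_ofReal ?_
        have : 2 * (s : ℝ) * (2 * B ^ 2 * n) = (4 * s * B ^ 2) * n := by ring
        rw [this]
        exact mul_le_mul_of_nonneg_right hM2 (by positivity)

lemma bound_f3 {B : ℝ} (hd : 0 < d) {θ a : Fin d → ℝ} (ha : ∀ k, 0 ≤ a k)
    (hB : ∀ k, |θ k| ≤ B) {M r : ℝ}
    (hM3 : 4 * B ^ 4 ≤ M) (hr : 0 < r) (hr2 : r ^ 2 = M * n) :
    ∫⁻ X, ENNReal.ofReal |(1 / (d : ℝ)) * offSum a θ X| ∂(gmat n d) ≤ ENNReal.ofReal r := by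
  have hd' : (0 : ℝ) < d := by exact_mod_cast hd
  refine lintegral_abs_le (meas_f3 θ ha) hr ?_
  rw [hr2]
  calc _ ≤ ∫⁻ X, ENNReal.ofReal ((1 / (d : ℝ)) ^ 2) * ENNReal.ofReal (offSum a θ X ^ 2)
          ∂(gmat n d) := by
        refine lintegral_mono fun X => ?_
        simp only
        rw [← ENNReal.ofReal_mul (by positivity), ← mul_pow]
    _ ≤ ENNReal.ofReal ((1 / (d : ℝ)) ^ 2) * ENNReal.ofReal (4 * B ^ 4 * n * d ^ 2) := by
        rw [lintegral_const_mul' _ _ ENNReal.ofReal_ne_top]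
        exact mul_le_mul_right (off_sum_le ha θ hB) _
    _ ≤ _ := by
        rw [← ENNReal.ofReal_mul (by positivity)]
        refine ENNReal.ofReal_le_ofReal ?_
        have : (1 / (d : ℝ)) ^ 2 * (4 * B ^ 4 * n * d ^ 2) = 4 * B ^ 4 * n := by field_simp
        rw [this]
        exact mul_le_mul_of_nonneg_right hM3 (by positivity)

lemma bound_f4 {a : Fin d → ℝ} (ha : ∀ k, 0 ≤ a k) (hn : 0 < n) {M r : ℝ}
    (hM4 : 2 * Kq 1 + 2 ≤ M) (hr : 0 < r) (hr2 : r ^ 2 = M * n) (k : Fin d) :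
    ∫⁻ X, ENNReal.ofReal |qk a X k - ((Amat a X)⁻¹).trace| ∂(gmat n d) ≤ ENNReal.ofReal r := by
  refine lintegral_abs_le (meas_f4 ha k) hr ?_
  rw [hr2]
  refine (qk_tr ha hn k).trans (ENNReal.ofReal_le_ofReal ?_)
  exact mul_le_mul_of_nonneg_right hM4 (by positivity)

lemma errT_bound (s : ℝ≥0) {B : ℝ} (hn : 0 < n) (hd : 0 < d)
    {θ a w : Fin d → ℝ} (ha : ∀ k, 0 ≤ a k) (hw : ∀ k, 0 ≤ w k)
    (hB : ∀ k, |θ k| ≤ B) {M W : ℝ} (hM0 : 0 < M) (hM1 : Kq s ≤ M) (hM2 : 4 * s * B ^ 2 ≤ M)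
    (hM3 : 4 * B ^ 4 ≤ M) (hM4 : 2 * Kq 1 + 2 ≤ M) (hW : ∑ k, w k ≤ W) :
    ∫⁻ ω, ENNReal.ofReal (errT s a θ w ω) ∂((gmat n d).prod (gvec n s)) ≤
      ENNReal.ofReal ((1 / (n : ℝ)) * ((4 + W) * Real.sqrt (M * n))) := by
  have hn' : (0 : ℝ) < n := by exact_mod_cast hn
  have hB2 : ∀ k, θ k ^ 2 ≤ B ^ 2 := fun k => sq_le_sq' (by linarith [(abs_le.mp (hB k)).1])
    (abs_le.mp (hB k)).2
  have hMn : 0 < M * n := by positivity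
  have hr : 0 < Real.sqrt (M * n) := Real.sqrt_pos.2 hMn
  have hr2 : Real.sqrt (M * n) ^ 2 = M * n := Real.sq_sqrt hMn.le
  have hfst : ∀ g : (Fin n → Fin d → ℝ) → ℝ≥0∞, Measurable g →
      ∫⁻ ω, g ω.1 ∂((gmat n d).prod (gvec n s)) = ∫⁻ X, g X ∂(gmat n d) := fun g hg =>
    (measurePreserving_fst (μ := gmat n d) (ν := gvec n s)).lintegral_comp hg
  have b3 := (hfst _ (meas_f3 θ ha).abs.ennreal_ofReal).le.trans
    (bound_f3 (n := n) hd ha hB hM3 hr hr2)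
  have b4 := fun k => (hfst _ (meas_f4 ha k).abs.ennreal_ofReal).le.trans
    (bound_f4 (n := n) ha hn hM4 hr hr2 k)
  exact combine_bound _ (meas_f1 s ha) (meas_f2 θ ha) ((meas_f3 θ ha).comp measurable_fst)
    (fun k => (meas_f4 ha k).comp measurable_fst) hr.le (bound_f1 s ha hM0 hM1 hr hr2)
    (bound_f2 s hd ha hB2 hM2 hr hr2) b3 b4 hw (by positivity) hW

end fin

/-! ### Scalar part -/

section scalar

/-- shrinkage factor -/
def uf (lam δ x : ℝ) : ℝ := 1 / (1 + x ^ 2 / lam * δ)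

lemma uf_pos {lam δ : ℝ} (hl : 0 < lam) (hδ : 0 ≤ δ) (x : ℝ) : 0 < uf lam δ x := by
  unfold uf; positivity

lemma uf_le {lam δ : ℝ} (hl : 0 < lam) (hδ : 0 ≤ δ) (x : ℝ) : uf lam δ x ≤ 1 := by
  unfold uf
  rw [div_le_one (by positivity)]
  have : 0 ≤ x ^ 2 / lam * δ := by positivity
  linarith

lemma continuous_uf {lam δ : ℝ} (hl : 0 < lam) (hδ : 0 ≤ δ) :
    Continuous fun p : ℝ × ℝ => uf lam δ p.1 := by
  unfold uf
  refine continuous_const.div (by fun_prop) fun p => ?_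
  positivity

lemma uf_c {lam δ : ℝ} (hl : 0 < lam) (hδ : 0 ≤ δ) (x : ℝ) :
    x ^ 2 / lam * (δ / (1 + x ^ 2 / lam * δ)) = 1 - uf lam δ x := by
  unfold uf
  have : 0 < 1 + x ^ 2 / lam * δ := by positivity
  rw [eq_sub_iff_add_eq, ← mul_div_assoc, ← add_div, add_comm, div_self this.ne']

lemma uf_lip {lam δ : ℝ} (hl : 0 < lam) (hδ : 0 ≤ δ) (x y : ℝ) :
    |uf lam δ x - uf lam δ y| ≤ δ / lam * (|x - y| * (|x| + |y|)) := by
  have hx : 1 ≤ 1 + x ^ 2 / lam * δ := by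
    have : 0 ≤ x ^ 2 / lam * δ := by positivity
    linarith
  have hy : 1 ≤ 1 + y ^ 2 / lam * δ := by
    have : 0 ≤ y ^ 2 / lam * δ := by positivity
    linarith
  have e : uf lam δ x - uf lam δ y =
      (δ / lam * ((y - x) * (x + y))) / ((1 + x ^ 2 / lam * δ) * (1 + y ^ 2 / lam * δ)) := by
    unfold uf
    rw [div_sub_div _ _ (by positivity) (by positivity)]
    congr 1
    ring
  rw [e, abs_div, abs_of_pos (by positivity : 0 < (1 + x ^ 2 / lam * δ) * (1 + y ^ 2 / lam * δ))]
  refine (div_le_self (abs_nonneg _) (by nlinarith)).trans ?_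
  rw [abs_mul, abs_mul, abs_of_nonneg (by positivity : 0 ≤ δ / lam), abs_sub_comm y x]
  gcongr
  exact abs_add_le _ _

lemma pl2_of {g : ℝ × ℝ → ℝ} {K1 K2 : ℝ} (h1 : 0 ≤ K1) (h2 : 0 ≤ K2)
    (h : ∀ x y : ℝ × ℝ, |g x - g y| ≤ K1 * |x.2 - y.2| + K2 * (|x.1 - y.1| * (|x.1| + |y.1|))) :
    PseudoLipschitz2Pair g := by
  refine ⟨K1 + K2 + 1, by positivity, fun x y => (h x y).trans ?_⟩
  have a1 : |x.2 - y.2| ≤ Real.sqrt ((x.1 - y.1) ^ 2 + (x.2 - y.2) ^ 2) :=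
    Real.abs_le_sqrt (by nlinarith [sq_nonneg (x.1 - y.1)])
  have a2 : |x.1 - y.1| ≤ Real.sqrt ((x.1 - y.1) ^ 2 + (x.2 - y.2) ^ 2) :=
    Real.abs_le_sqrt (by nlinarith [sq_nonneg (x.2 - y.2)])
  have a3 : |x.1| ≤ Real.sqrt (x.1 ^ 2 + x.2 ^ 2) := Real.abs_le_sqrt (by nlinarith [sq_nonneg x.2])
  have a4 : |y.1| ≤ Real.sqrt (y.1 ^ 2 + y.2 ^ 2) := Real.abs_le_sqrt (by nlinarith [sq_nonneg y.2])
  set D := Real.sqrt ((x.1 - y.1) ^ 2 + (x.2 - y.2) ^ 2)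
  set P := Real.sqrt (x.1 ^ 2 + x.2 ^ 2)
  set R := Real.sqrt (y.1 ^ 2 + y.2 ^ 2)
  have hD : 0 ≤ D := Real.sqrt_nonneg _
  have hP : 0 ≤ P := Real.sqrt_nonneg _
  have hR : 0 ≤ R := Real.sqrt_nonneg _
  have b1 : K1 * |x.2 - y.2| ≤ K1 * D := mul_le_mul_of_nonneg_left a1 h1
  have b2 : K2 * (|x.1 - y.1| * (|x.1| + |y.1|)) ≤ K2 * (D * (P + R)) := by gcongr
  have c1 : 0 ≤ K1 * (D * (P + R)) := by positivity
  have c2 : 0 ≤ K2 * D := by positivity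
  have c3 : 0 ≤ D * (1 + P + R) := by positivity
  nlinarith

lemma int_bdd {Pit : Measure (ℝ × ℝ)} [IsProbabilityMeasure Pit] {f : ℝ × ℝ → ℝ}
    (hf : Measurable f) (C : ℝ) (h : ∀ᵐ p ∂Pit, |f p| ≤ C) : Integrable f Pit :=
  Integrable.of_bound hf.aestronglyMeasurable C (by simpa using h)

lemma fixed_point {κ lam : ℝ} (hκ : 0 < κ) (hl : 0 < lam) (Pit : Measure (ℝ × ℝ))
    [IsProbabilityMeasure Pit] :
    ∃ δ : ℝ, 0 < δ ∧ δ ≤ 1 ∧ δ + κ * ∫ p, (1 - uf lam δ p.1) ∂Pit = 1 := by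
  have hcont : Continuous fun δ : ℝ => δ + κ * ∫ p, (1 - uf lam |δ| p.1) ∂Pit := by
    refine continuous_id.add (continuous_const.mul ?_)
    refine continuous_of_dominated (bound := fun _ => (1 : ℝ)) ?_ ?_ ?_ ?_
    · intro δ
      exact (continuous_const.sub (continuous_uf hl (abs_nonneg δ))).aestronglyMeasurable
    · intro δ
      refine ae_of_all _ fun p => ?_
      have := uf_pos hl (abs_nonneg δ) p.1
      have := uf_le hl (abs_nonneg δ) p.1
      rw [Real.norm_eq_abs, abs_le]; constructor <;> linarith
    · exact integrable_const _
    · refine ae_of_all _ fun p => continuous_const.sub ?_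
      unfold uf
      refine continuous_const.div (by fun_prop) fun p => ?_
      positivity
  have h0 : (fun δ : ℝ => δ + κ * ∫ p, (1 - uf lam |δ| p.1) ∂Pit) 0 = 0 := by
    simp [uf]
  have h1 : 1 ≤ (fun δ : ℝ => δ + κ * ∫ p, (1 - uf lam |δ| p.1) ∂Pit) 1 := by
    have : 0 ≤ ∫ p, (1 - uf lam |(1 : ℝ)| p.1) ∂Pit :=
      integral_nonneg fun p => by
        have := uf_le hl (abs_nonneg 1) p.1
        simp only [Pi.zero_apply]; linarith
    have := mul_nonneg hκ.le this
    simp only; linarith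
  obtain ⟨δ, ⟨hδ0, hδ1⟩, hδ⟩ := intermediate_value_Icc zero_le_one hcont.continuousOn
    (show (1 : ℝ) ∈ Set.Icc _ _ from ⟨h0.le.trans zero_le_one, h1⟩)
  have hne : δ ≠ 0 := by
    rintro rfl
    exact zero_ne_one (h0.symm.trans hδ)
  refine ⟨δ, lt_of_le_of_ne hδ0 hne.symm, hδ1, ?_⟩
  simpa [abs_of_nonneg hδ0] using hδ

variable {κ lam B δ : ℝ} {Pit : Measure (ℝ × ℝ)}

/-- pointwise identity at the optimum -/
lemma pt_eq (hl : 0 < lam) (hδ : 0 < δ) {b : ℝ} (hb : 0 < b) (κ x t : ℝ) :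
    lam * ((t ^ 2 + b ^ 2 * κ) / (δ * b * x ^ 2 + b * lam)) =
      t ^ 2 * uf lam δ x / b + κ * b * uf lam δ x := by
  unfold uf
  have : 0 < 1 + x ^ 2 / lam * δ := by positivity
  have h3 : δ * b * x ^ 2 + b * lam = b * lam * (1 + x ^ 2 / lam * δ) := by field_simp; ring
  rw [h3]
  field_simp

/-- pointwise tangent inequality -/
lemma pt_ge (hl : 0 < lam) (hδ : 0 < δ) (hκ : 0 < κ) {b : ℝ} (hb : 0 < b) {β : ℝ} (hβ : 0 < β)
    (x t : ℝ) :
    t ^ 2 * uf lam δ x / b + κ * b * uf lam δ x +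
      (β - b) * (- (t ^ 2 * uf lam δ x ^ 2 / b ^ 2) + κ * (2 * uf lam δ x - uf lam δ x ^ 2)) ≤
    lam * ((t ^ 2 + β ^ 2 * κ) / (δ * b * x ^ 2 + β * lam)) := by
  have hu := uf_pos hl hδ.le x
  have hu1 := uf_le hl hδ.le x
  have hL : δ * b * x ^ 2 + β * lam = lam * (b / uf lam δ x + (β - b)) := by
    unfold uf
    have : 0 < 1 + x ^ 2 / lam * δ := by positivity
    field_simp; ring
  set u := uf lam δ x
  have hq : 0 < b / u + (β - b) := by
    have : b ≤ b / u := le_div_self hb.le hu hu1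
    linarith
  have hq2 : 0 < b + (β - b) * u := by
    have := mul_pos hq hu
    have e : (b / u + (β - b)) * u = b + (β - b) * u := by field_simp
    linarith
  have e2 : lam * ((t ^ 2 + β ^ 2 * κ) / (δ * b * x ^ 2 + β * lam)) =
      (t ^ 2 + β ^ 2 * κ) * u / (b + (β - b) * u) := by
    rw [hL]
    have e : b / u + (β - b) = (b + (β - b) * u) / u := by field_simp
    rw [e]
    field_simp
  rw [e2, le_div_iff₀ hq2]
  have e3 : (t ^ 2 * u / b + κ * b * u +
      (β - b) * (- (t ^ 2 * u ^ 2 / b ^ 2) + κ * (2 * u - u ^ 2))) * (b + (β - b) * u) =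
      (t ^ 2 + β ^ 2 * κ) * u - u * ((t * u * (β - b) / b) ^ 2 + κ * ((β - b) * (1 - u)) ^ 2) := by
    field_simp
    ring
  rw [e3]
  have : 0 ≤ u * ((t * u * (β - b) / b) ^ 2 + κ * ((β - b) * (1 - u)) ^ 2) := by positivity
  linarith

/-- limiting value -/
def Gv (σ lam δ : ℝ) (Pit : Measure (ℝ × ℝ)) : ℝ :=
  σ ^ 2 * δ + δ * ∫ p, p.2 ^ 2 * uf lam δ p.1 ∂Pit

lemma int_uf [IsProbabilityMeasure Pit] (hl : 0 < lam) (hδ : 0 < δ) :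
    Integrable (fun p : ℝ × ℝ => uf lam δ p.1) Pit :=
  int_bdd (continuous_uf hl hδ.le).measurable 1 (ae_of_all _ fun p => by
    rw [abs_of_pos (uf_pos hl hδ.le _)]; exact uf_le hl hδ.le _)

lemma int_uf2 [IsProbabilityMeasure Pit] (hl : 0 < lam) (hδ : 0 < δ) :
    Integrable (fun p : ℝ × ℝ => uf lam δ p.1 ^ 2) Pit :=
  int_bdd ((continuous_uf hl hδ.le).pow 2).measurable 1 (ae_of_all _ fun p => by
    rw [abs_of_nonneg (sq_nonneg _)]
    exact pow_le_one₀ (uf_pos hl hδ.le _).le (uf_le hl hδ.le _))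

lemma int_tuf [IsProbabilityMeasure Pit] (hl : 0 < lam) (hδ : 0 < δ)
    (hB : ∀ᵐ p ∂Pit, |p.2| ≤ B) :
    Integrable (fun p : ℝ × ℝ => p.2 ^ 2 * uf lam δ p.1) Pit := by
  refine int_bdd ((continuous_snd.pow 2).mul (continuous_uf hl hδ.le)).measurable (B ^ 2) ?_
  filter_upwards [hB] with p hp
  have h1 : p.2 ^ 2 ≤ B ^ 2 := by rw [← sq_abs]; gcongr
  have h2 := uf_pos hl hδ.le p.1
  rw [abs_of_nonneg (by positivity)]
  calc _ ≤ B ^ 2 * 1 := mul_le_mul h1 (uf_le hl hδ.le _) h2.le (sq_nonneg _)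
    _ = _ := mul_one _

lemma int_tuf2 [IsProbabilityMeasure Pit] (hl : 0 < lam) (hδ : 0 < δ)
    (hB : ∀ᵐ p ∂Pit, |p.2| ≤ B) :
    Integrable (fun p : ℝ × ℝ => p.2 ^ 2 * uf lam δ p.1 ^ 2) Pit := by
  refine int_bdd ((continuous_snd.pow 2).mul ((continuous_uf hl hδ.le).pow 2)).measurable
    (B ^ 2) ?_
  filter_upwards [hB] with p hp
  have h1 : p.2 ^ 2 ≤ B ^ 2 := by rw [← sq_abs]; gcongr
  have h2 := uf_pos hl hδ.le p.1
  rw [abs_of_nonneg (by positivity)]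
  calc _ ≤ B ^ 2 * 1 := mul_le_mul h1 (pow_le_one₀ h2.le (uf_le hl hδ.le _)) (by positivity)
        (sq_nonneg _)
    _ = _ := mul_one _

lemma int_obj [IsProbabilityMeasure Pit] (hl : 0 < lam) (hκ : 0 < κ)
    (hB : ∀ᵐ p ∂Pit, |p.2| ≤ B) {τ β : ℝ} (hτ : 0 < τ) (hβ : 0 < β) :
    Integrable (fun p : ℝ × ℝ => (p.2 ^ 2 + β ^ 2 * κ) / (τ * p.1 ^ 2 + β * lam)) Pit := by
  refine int_bdd ?_ ((B ^ 2 + β ^ 2 * κ) / (β * lam)) ?_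
  · exact Measurable.div (by fun_prop) (by fun_prop)
  · filter_upwards [hB] with p hp
    have h1 : p.2 ^ 2 ≤ B ^ 2 := by rw [← sq_abs]; gcongr
    rw [abs_of_nonneg (by positivity)]
    have h2 : 0 ≤ τ * p.1 ^ 2 := by positivity
    have h3 : 0 < β * lam := by positivity
    exact div_le_div₀ (by positivity) (by linarith) h3 (by linarith)

lemma obj_eq [IsProbabilityMeasure Pit] (hl : 0 < lam) (hδ : 0 < δ) (σ : ℝ)
    (hB : ∀ᵐ p ∂Pit, |p.2| ≤ B) (hfix : δ + κ * ∫ p, (1 - uf lam δ p.1) ∂Pit = 1)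
    {b : ℝ} (hb : 0 < b) : scalarObj σ lam κ Pit (δ * b) b = Gv σ lam δ Pit := by
  have iu := int_uf (Pit := Pit) hl hδ
  have it := int_tuf hl hδ hB
  unfold scalarObj Gv
  rw [mul_assoc _ lam, ← integral_const_mul]
  simp_rw [pt_eq hl hδ hb κ]
  rw [integral_add (it.div_const _) (iu.const_mul _), integral_div, integral_const_mul]
  rw [integral_sub (integrable_const _) iu] at hfix
  simp only [integral_const, probReal_univ, smul_eq_mul, mul_one] at hfix
  generalize ∫ p, uf lam δ p.1 ∂Pit = U at hfix ⊢
  generalize ∫ p, p.2 ^ 2 * uf lam δ p.1 ∂Pit = T at hfix ⊢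
  have e : κ * U = δ + κ - 1 := by linarith
  have : δ * b * (T / b + κ * b * U) = δ * T + δ * b ^ 2 * (κ * U) := by field_simp
  rw [this, e]
  field_simp
  ring

lemma obj_ge [IsProbabilityMeasure Pit] (hl : 0 < lam) (hδ : 0 < δ) (hκ : 0 < κ) (σ : ℝ)
    (hB : ∀ᵐ p ∂Pit, |p.2| ≤ B) (hfix : δ + κ * ∫ p, (1 - uf lam δ p.1) ∂Pit = 1)
    {b : ℝ} (hb : 0 < b)
    (hopt : σ ^ 2 + ∫ p, p.2 ^ 2 * uf lam δ p.1 ^ 2 ∂Pit =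
      b ^ 2 * (1 - κ + κ * (2 * ∫ p, uf lam δ p.1 ∂Pit - ∫ p, uf lam δ p.1 ^ 2 ∂Pit)))
    {β : ℝ} (hβ : 0 < β) : Gv σ lam δ Pit ≤ scalarObj σ lam κ Pit (δ * b) β := by
  have iu := int_uf (Pit := Pit) hl hδ
  have iu2 := int_uf2 (Pit := Pit) hl hδ
  have it := int_tuf hl hδ hB
  have it2 := int_tuf2 hl hδ hB
  have hδb : 0 < δ * b := by positivity
  have h1 : ∫ p, (p.2 ^ 2 * uf lam δ p.1 / b + κ * b * uf lam δ p.1 +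
      (β - b) * (- (p.2 ^ 2 * uf lam δ p.1 ^ 2 / b ^ 2) +
        κ * (2 * uf lam δ p.1 - uf lam δ p.1 ^ 2))) ∂Pit ≤
      ∫ p, lam * ((p.2 ^ 2 + β ^ 2 * κ) / (δ * b * p.1 ^ 2 + β * lam)) ∂Pit := by
    refine integral_mono ?_ ((int_obj hl hκ hB hδb hβ).const_mul _) fun p => pt_ge hl hδ hκ hb hβ _ _
    exact ((it.div_const _).add (iu.const_mul _)).add
      (((it2.div_const _).neg.add (((iu.const_mul _).sub iu2).const_mul _)).const_mul _)
  have i1 : Integrable (fun p : ℝ × ℝ => p.2 ^ 2 * uf lam δ p.1 / b) Pit := it.div_const _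
  have i2 : Integrable (fun p : ℝ × ℝ => κ * b * uf lam δ p.1) Pit := iu.const_mul _
  have i3 : Integrable (fun p : ℝ × ℝ => - (p.2 ^ 2 * uf lam δ p.1 ^ 2 / b ^ 2)) Pit :=
    (it2.div_const _).neg
  have i5 : Integrable (fun p : ℝ × ℝ => 2 * uf lam δ p.1) Pit := iu.const_mul _
  have i4 : Integrable (fun p : ℝ × ℝ => κ * (2 * uf lam δ p.1 - uf lam δ p.1 ^ 2)) Pit :=
    (i5.sub iu2).const_mul _
  have i12 : Integrable (fun p : ℝ × ℝ => p.2 ^ 2 * uf lam δ p.1 / b + κ * b * uf lam δ p.1) Pit :=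
    i1.add i2
  have i34 : Integrable (fun p : ℝ × ℝ => (β - b) * (- (p.2 ^ 2 * uf lam δ p.1 ^ 2 / b ^ 2) +
      κ * (2 * uf lam δ p.1 - uf lam δ p.1 ^ 2))) Pit := (i3.add i4).const_mul _
  rw [integral_add i12 i34, integral_add i1 i2,
    integral_const_mul (β - b), integral_add i3 i4, integral_const_mul κ, integral_sub i5 iu2,
    integral_const_mul 2, integral_neg, integral_div, integral_div,
    integral_const_mul (κ * b)] at h1
  have h0 := obj_eq hl hδ σ hB hfix hb
  have e0 : ∫ p, lam * ((p.2 ^ 2 + b ^ 2 * κ) / (δ * b * p.1 ^ 2 + b * lam)) ∂Pit =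
      (∫ p, p.2 ^ 2 * uf lam δ p.1 ∂Pit) / b + κ * b * ∫ p, uf lam δ p.1 ∂Pit := by
    simp_rw [pt_eq hl hδ hb κ]
    rw [integral_add i1 i2, integral_div, integral_const_mul (κ * b)]
  rw [← h0]
  unfold scalarObj
  rw [mul_assoc _ lam, mul_assoc _ lam, ← integral_const_mul lam, ← integral_const_mul lam, e0]
  generalize ∫ p, lam * ((p.2 ^ 2 + β ^ 2 * κ) / (δ * b * p.1 ^ 2 + β * lam)) ∂Pit = I at h1 ⊢
  generalize ∫ p, uf lam δ p.1 ∂Pit = U at h1 hopt ⊢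
  generalize ∫ p, uf lam δ p.1 ^ 2 ∂Pit = U2 at h1 hopt ⊢
  generalize ∫ p, p.2 ^ 2 * uf lam δ p.1 ∂Pit = T at h1 hopt ⊢
  generalize ∫ p, p.2 ^ 2 * uf lam δ p.1 ^ 2 ∂Pit = T2 at h1 hopt ⊢
  have h2 : σ ^ 2 / b - σ ^ 2 * (β - b) / b ^ 2 ≤ σ ^ 2 / β := by
    have : σ ^ 2 / β - (σ ^ 2 / b - σ ^ 2 * (β - b) / b ^ 2) = σ ^ 2 * (β - b) ^ 2 / (β * b ^ 2) := by
      field_simp; ring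
    have h3 : 0 ≤ σ ^ 2 * (β - b) ^ 2 / (β * b ^ 2) := by positivity
    linarith
  have h4 : σ ^ 2 / b ^ 2 + T2 / b ^ 2 = 1 - κ + κ * (2 * U - U2) := by
    rw [← add_div, hopt]; field_simp
  have h5 : σ ^ 2 / b + b * (1 - κ) + (T / b + κ * b * U) ≤ σ ^ 2 / β + β * (1 - κ) + I := by
    have e : σ ^ 2 * (β - b) / b ^ 2 = (β - b) * (1 - κ + κ * (2 * U - U2)) -
        (β - b) * (T2 / b ^ 2) := by
      rw [← h4]; ring
    rw [e] at h2
    linarith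
  have h6 := mul_le_mul_of_nonneg_left h5 hδb.le
  have e1 : δ * b * σ ^ 2 / b = δ * b * (σ ^ 2 / b) := by ring
  have e2 : δ * b * σ ^ 2 / β = δ * b * (σ ^ 2 / β) := by ring
  rw [e1, e2]
  linarith

lemma value_eq [IsProbabilityMeasure Pit] (hl : 0 < lam) (hδ : 0 < δ) (hκ : 0 < κ) (σ : ℝ)
    (hB : ∀ᵐ p ∂Pit, |p.2| ≤ B) (hfix : δ + κ * ∫ p, (1 - uf lam δ p.1) ∂Pit = 1) :
    (⨆ τ : {τ : ℝ // 0 ≤ τ}, ⨅ β : {β : ℝ // 0 < β}, scalarObj σ lam κ Pit (τ : ℝ) (β : ℝ)) =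
      Gv σ lam δ Pit := by
  have iu := int_uf (Pit := Pit) hl hδ
  have iu2 := int_uf2 (Pit := Pit) hl hδ
  have it2 := int_tuf2 hl hδ hB
  have hT : 0 ≤ ∫ p, p.2 ^ 2 * uf lam δ p.1 ∂Pit := integral_nonneg fun p =>
    mul_nonneg (sq_nonneg _) (uf_pos hl hδ.le _).le
  have hT2 : 0 ≤ ∫ p, p.2 ^ 2 * uf lam δ p.1 ^ 2 ∂Pit := integral_nonneg fun p =>
    mul_nonneg (sq_nonneg _) (sq_nonneg _)
  have hG : 0 ≤ Gv σ lam δ Pit := by unfold Gv; positivity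
  have : Nonempty {β : ℝ // 0 < β} := ⟨⟨1, one_pos⟩⟩
  have : Nonempty {τ : ℝ // 0 ≤ τ} := ⟨⟨0, le_rfl⟩⟩
  have hzero : (⨅ β : {β : ℝ // 0 < β}, scalarObj σ lam κ Pit 0 (β : ℝ)) = 0 := by
    simp [scalarObj]
  have hup : ∀ τ : {τ : ℝ // 0 ≤ τ},
      (⨅ β : {β : ℝ // 0 < β}, scalarObj σ lam κ Pit (τ : ℝ) (β : ℝ)) ≤ Gv σ lam δ Pit := by
    rintro ⟨τ, hτ⟩
    rcases hτ.eq_or_lt with h | h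
    · subst h
      simp only
      rw [hzero]; exact hG
    · by_cases hb : BddBelow (Set.range fun β : {β : ℝ // 0 < β} => scalarObj σ lam κ Pit τ (β : ℝ))
      · have hb0 : 0 < τ / δ := by positivity
        refine (ciInf_le hb ⟨τ / δ, hb0⟩).trans ?_
        have := obj_eq hl hδ σ hB hfix hb0
        rw [mul_div_cancel₀ _ hδ.ne'] at this
        exact this.le
      · rw [Real.iInf_of_not_bddBelow hb]; exact hG
  have hatt : ∃ τ : {τ : ℝ // 0 ≤ τ},
      Gv σ lam δ Pit ≤ ⨅ β : {β : ℝ // 0 < β}, scalarObj σ lam κ Pit (τ : ℝ) (β : ℝ) := by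
    have hN0 : 0 ≤ σ ^ 2 + ∫ p, p.2 ^ 2 * uf lam δ p.1 ^ 2 ∂Pit := by positivity
    rcases hN0.eq_or_lt with hN | hN
    · refine ⟨⟨0, le_rfl⟩, ?_⟩
      simp only
      rw [hzero]
      have hσ : σ ^ 2 = 0 := by linarith [sq_nonneg σ]
      have hI : ∫ p, p.2 ^ 2 * uf lam δ p.1 ^ 2 ∂Pit = 0 := by linarith
      rw [integral_eq_zero_iff_of_nonneg (fun p => mul_nonneg (sq_nonneg _) (sq_nonneg _)) it2] at hI
      have hI2 : ∫ p, p.2 ^ 2 * uf lam δ p.1 ∂Pit = 0 := by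
        refine integral_eq_zero_of_ae ?_
        filter_upwards [hI] with p hp
        have hu := uf_pos hl hδ.le p.1
        simp only [Pi.zero_apply, mul_eq_zero] at hp ⊢
        left
        rcases hp with h | h
        · exact h
        · exact absurd h (by positivity)
      unfold Gv
      rw [hσ, hI2]; simp
    · set m := 1 - κ + κ * (2 * ∫ p, uf lam δ p.1 ∂Pit - ∫ p, uf lam δ p.1 ^ 2 ∂Pit) with hm
      have hle : ∫ p, uf lam δ p.1 ^ 2 ∂Pit ≤ ∫ p, uf lam δ p.1 ∂Pit := by
        refine integral_mono iu2 iu fun p => ?_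
        have h1 := uf_pos hl hδ.le p.1
        have h2 := uf_le hl hδ.le p.1
        simp only
        nlinarith
      have hm0 : 0 < m := by
        rw [integral_sub (integrable_const _) iu] at hfix
        simp only [integral_const, probReal_univ, smul_eq_mul, mul_one] at hfix
        have := mul_le_mul_of_nonneg_left hle hκ.le
        rw [hm]
        linarith
      set N := σ ^ 2 + ∫ p, p.2 ^ 2 * uf lam δ p.1 ^ 2 ∂Pit with hNd
      have hb : 0 < Real.sqrt (N / m) := Real.sqrt_pos.2 (by positivity)
      refine ⟨⟨δ * Real.sqrt (N / m), by positivity⟩, ?_⟩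
      refine le_ciInf fun β => ?_
      refine obj_ge hl hδ hκ σ hB hfix hb ?_ β.2
      rw [Real.sq_sqrt (by positivity), ← hm, ← hNd]
      field_simp
  refine le_antisymm (ciSup_le hup) ?_
  obtain ⟨τ, hτ⟩ := hatt
  refine hτ.trans (le_ciSup (f := fun τ : {τ : ℝ // 0 ≤ τ} =>
    ⨅ β : {β : ℝ // 0 < β}, scalarObj σ lam κ Pit (τ : ℝ) (β : ℝ)) ⟨Gv σ lam δ Pit, ?_⟩ τ)
  rintro _ ⟨τ, rfl⟩
  exact hup τ

end scalar

/-! ### Limits and conclusion -/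

section final

lemma clip_sq_lip {B : ℝ} (hB : 0 ≤ B) (x y : ℝ) :
    |min |x| B ^ 2 - min |y| B ^ 2| ≤ 2 * B * |x - y| := by
  have h1 : |min |x| B - min |y| B| ≤ |x - y| := by
    refine (abs_min_sub_min_le_max _ _ _ _).trans ?_
    simp only [sub_self, abs_zero]
    exact max_le (abs_abs_sub_abs_le _ _) (abs_nonneg _)
  have hx : 0 ≤ min |x| B := le_min (abs_nonneg _) hB
  have hy : 0 ≤ min |y| B := le_min (abs_nonneg _) hB
  have hx2 : min |x| B ≤ B := min_le_right _ _
  have hy2 : min |y| B ≤ B := min_le_right _ _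
  have e : min |x| B ^ 2 - min |y| B ^ 2 = (min |x| B + min |y| B) * (min |x| B - min |y| B) := by
    ring
  rw [e, abs_mul, abs_of_nonneg (add_nonneg hx hy)]
  exact mul_le_mul (by linarith) h1 (abs_nonneg _) (by positivity)

lemma pl2_sq : PseudoLipschitz2Pair fun p => p.1 ^ 2 := by
  refine pl2_of (K1 := 0) (K2 := 1) le_rfl zero_le_one fun x y => ?_
  have e : x.1 ^ 2 - y.1 ^ 2 = (x.1 - y.1) * (x.1 + y.1) := by ring
  rw [e, abs_mul, zero_mul, zero_add, one_mul]
  exact mul_le_mul_of_nonneg_left (abs_add_le _ _) (abs_nonneg _)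

lemma pl2_uf {lam δ : ℝ} (hl : 0 < lam) (hδ : 0 ≤ δ) :
    PseudoLipschitz2Pair fun p => 1 - uf lam δ p.1 := by
  refine pl2_of (K1 := 0) (K2 := δ / lam) le_rfl (by positivity) fun x y => ?_
  have e : 1 - uf lam δ x.1 - (1 - uf lam δ y.1) = uf lam δ y.1 - uf lam δ x.1 := by ring
  rw [e, abs_sub_comm, zero_mul, zero_add]
  exact uf_lip hl hδ _ _

lemma pl2_tuf {lam δ B : ℝ} (hl : 0 < lam) (hδ : 0 ≤ δ) (hB : 0 ≤ B) :
    PseudoLipschitz2Pair fun p => min |p.2| B ^ 2 * uf lam δ p.1 := by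
  refine pl2_of (K1 := 2 * B) (K2 := B ^ 2 * (δ / lam)) (by positivity) (by positivity) fun x y => ?_
  have e : min |x.2| B ^ 2 * uf lam δ x.1 - min |y.2| B ^ 2 * uf lam δ y.1 =
      (min |x.2| B ^ 2 - min |y.2| B ^ 2) * uf lam δ x.1 +
        min |y.2| B ^ 2 * (uf lam δ x.1 - uf lam δ y.1) := by ring
  rw [e]
  have hu := uf_pos hl hδ x.1
  have hu1 := uf_le hl hδ x.1
  have hy : 0 ≤ min |y.2| B := le_min (abs_nonneg _) hB
  have hy2 : min |y.2| B ^ 2 ≤ B ^ 2 := pow_le_pow_left₀ hy (min_le_right _ _) 2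
  refine (abs_add_le _ _).trans (add_le_add ?_ ?_)
  · rw [abs_mul, abs_of_pos hu]
    calc _ ≤ (2 * B * |x.2 - y.2|) * 1 :=
          mul_le_mul (clip_sq_lip hB _ _) hu1 hu.le (by positivity)
      _ = _ := mul_one _
  · rw [abs_mul, abs_of_nonneg (sq_nonneg _), mul_assoc]
    exact mul_le_mul hy2 (uf_lip hl hδ _ _) (abs_nonneg _) (sq_nonneg _)

lemma pl2_exc (B : ℝ) : PseudoLipschitz2Pair fun p => min (max (|p.2| - B) 0) 1 := by
  refine pl2_of (K1 := 1) (K2 := 0) zero_le_one le_rfl fun x y => ?_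
  rw [zero_mul, add_zero, one_mul]
  refine (abs_min_sub_min_le_max _ _ _ _).trans ?_
  simp only [sub_self, abs_zero]
  refine max_le ((abs_max_sub_max_le_max _ _ _ _).trans ?_) (abs_nonneg _)
  simp only [sub_self, abs_zero, sub_sub_sub_cancel_right]
  exact max_le (abs_abs_sub_abs_le _ _) (abs_nonneg _)

lemma ae_bound {d : ℕ → ℕ} {v θ : (j : ℕ) → Fin (d j) → ℝ} {Pit : Measure (ℝ × ℝ)}
    [IsProbabilityMeasure Pit] {B : ℝ} (hB : ∀ j i, |θ j i| ≤ B)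
    (hW2 : ∀ g : ℝ × ℝ → ℝ, PseudoLipschitz2Pair g →
      Tendsto (fun j => (d j : ℝ)⁻¹ * ∑ i, g (v j i, θ j i)) atTop
        (𝓝 (∫ p, g p ∂Pit))) : ∀ᵐ p ∂Pit, |p.2| ≤ B := by
  have h := hW2 _ (pl2_exc B)
  have h0 : ∀ j, (d j : ℝ)⁻¹ * ∑ i, min (max (|(v j i, θ j i).2| - B) 0) 1 = 0 := by
    intro j
    rw [Finset.sum_eq_zero, mul_zero]
    intro i _
    have : max (|θ j i| - B) 0 = 0 := max_eq_right (by linarith [hB j i])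
    simp only [this]
    exact min_eq_left zero_le_one
  simp_rw [h0] at h
  have h1 : ∫ p, min (max (|p.2| - B) 0) 1 ∂Pit = 0 := tendsto_nhds_unique h tendsto_const_nhds
  have hnn : ∀ p : ℝ × ℝ, 0 ≤ min (max (|p.2| - B) 0) 1 := fun p =>
    le_min (le_max_right _ _) zero_le_one
  have hintg : Integrable (fun p : ℝ × ℝ => min (max (|p.2| - B) 0) 1) Pit := by
    refine int_bdd (by fun_prop) 1 (ae_of_all _ fun p => ?_)
    rw [abs_of_nonneg (hnn p)]
    exact min_le_right _ _
  rw [integral_eq_zero_iff_of_nonneg hnn hintg] at h1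
  filter_upwards [h1] with p hp
  simp only [Pi.zero_apply] at hp
  by_contra hc
  push Not at hc
  have : 0 < min (max (|p.2| - B) 0) 1 := lt_min (lt_max_of_lt_left (by linarith)) one_pos
  linarith

lemma meas_errT {n d : ℕ} (s : ℝ≥0) {θ a w : Fin d → ℝ} (ha : ∀ k, 0 ≤ a k) :
    Measurable (errT (n := n) s a θ w) := by
  have m1 := meas_f1 (n := n) s ha
  have m2 := meas_f2 (n := n) θ ha
  have m3 : Measurable fun ω : (Fin n → Fin d → ℝ) × (Fin n → ℝ) => (1 / (d : ℝ)) * offSum a θ ω.1 :=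
    (meas_f3 θ ha).comp measurable_fst
  have m4 : ∀ k, Measurable fun ω : (Fin n → Fin d → ℝ) × (Fin n → ℝ) =>
      qk a ω.1 k - ((Amat a ω.1)⁻¹).trace := fun k => (meas_f4 ha k).comp measurable_fst
  exact (((m1.abs.add (m2.abs.const_mul 2)).add m3.abs).add
    (Finset.measurable_sum _ fun k _ => (m4 k).abs.const_mul (w k))).const_mul _

lemma ridge_form {n d : ℕ} (hn : 0 < n) (hd : 0 < d) {lam : ℝ} (hl : 0 < lam) (v θ : Fin d → ℝ)
    (ω : (Fin n → Fin d → ℝ) × (Fin n → ℝ)) :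
    (⨅ u : Fin d → ℝ, ((1 / (n : ℝ)) * ∑ i,
      ((1 / Real.sqrt d) * ∑ k, ω.1 i k * θ k + ω.2 i
        - (1 / Real.sqrt d) * ∑ k, ω.1 i k * (u k * v k)) ^ 2
      + (lam / (d : ℝ)) * ∑ k, u k ^ 2)) =
    (1 / (n : ℝ)) * (dotProduct (zvec θ ω.1 + ω.2)
      (((Amat (fun k => v k ^ 2 / lam / n) ω.1)⁻¹).mulVec (zvec θ ω.1 + ω.2))) := by
  have hn' : (0 : ℝ) < n := by exact_mod_cast hn
  have hd' : (0 : ℝ) < d := by exact_mod_cast hd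
  have hs : Real.sqrt d ^ 2 = d := Real.sq_sqrt hd'.le
  have hs0 : 0 < Real.sqrt d := Real.sqrt_pos.2 hd'
  have ha : ∀ k, 0 ≤ (fun k => v k ^ 2 / lam / n) k := fun k => by simp only; positivity
  rw [← ridge_min (a := fun k => v k ^ 2 / lam / n) (c := 1 / (n : ℝ)) (m := lam / d) (by positivity) (by positivity)
    (fun k => v k / Real.sqrt d) (by
      intro k
      simp only [div_pow, hs]
      field_simp) ha ω.1 (zvec θ ω.1 + ω.2)]
  congr 1
  funext u
  congr 2
  refine Finset.sum_congr rfl fun i _ => ?_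
  congr 1
  rw [Pi.add_apply, zvec_apply, dotProduct, Finset.mul_sum, Finset.mul_sum]
  congr 1
  · congr 1
    exact Finset.sum_congr rfl fun k _ => by ring
  · exact Finset.sum_congr rfl fun k _ => by ring

end final

/-- Under the stated assumptions on `(v, θ*)` (all entries of `v` nonzero,
empirical distribution of `(vᵢ, θ*ᵢ)` converging in Wasserstein-2 to `Π_t` with `V ≠ 0` a.s.,
and uniformly bounded entries of `θ*`), with `y = (1/√d)Xθ* + ε` for Gaussian data `(X, ε)`,
the optimal ridge value `min_u (1/n)‖y − (1/√d)X(u ⊙ v)‖₂² + (λ/d)‖u‖₂²` converges in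
probability, as `n, d → ∞` with `d/n = κ` fixed, to
`P̄ = max_{τ≥0} min_{β>0}[τσ²/β + τβ(1 − κ) − τ² + τλ E[(Θ² + β²κ)/(τV² + βλ)]]`. -/
theorem ridge_value_converges_in_probability
    (κ : ℝ) (hκ : 0 < κ) (σ : ℝ≥0) (lam : ℝ) (hlam : 0 < lam)
    (n d : ℕ → ℕ) (hn : Tendsto n atTop atTop) (hd : Tendsto d atTop atTop)
    (hratio : ∀ j, (d j : ℝ) / (n j : ℝ) = κ)
    (v θstar : (j : ℕ) → Fin (d j) → ℝ)
    (hvne : ∀ j i, v j i ≠ 0)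
    (Pit : Measure (ℝ × ℝ)) (hPit : IsProbabilityMeasure Pit)
    (hW2 : ∀ g : ℝ × ℝ → ℝ, PseudoLipschitz2Pair g →
      Tendsto (fun j => (d j : ℝ)⁻¹ * ∑ i, g (v j i, θstar j i)) atTop
        (𝓝 (∫ p, g p ∂Pit)))
    (hVne : ∀ᵐ p ∂Pit, p.1 ≠ 0)
    (hθbdd : ∃ B : ℝ, ∀ j i, |θstar j i| ≤ B) :
    ∀ ε > (0 : ℝ),
      Tendsto (fun j =>
        batchMeasure (n j) (d j) σ
          {ω | ε ≤
            |(⨅ u : Fin (d j) → ℝ,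
                ((1 / (n j : ℝ)) * ∑ i,
                  ((1 / Real.sqrt (d j)) * ∑ k, ω.1 i k * θstar j k + ω.2 i
                    - (1 / Real.sqrt (d j)) * ∑ k, ω.1 i k * (u k * v j k)) ^ 2
                  + (lam / (d j : ℝ)) * ∑ k, u k ^ 2))
              - (⨆ τ : {τ : ℝ // 0 ≤ τ}, ⨅ β : {β : ℝ // 0 < β},
                  scalarObj (σ : ℝ) lam κ Pit (τ : ℝ) (β : ℝ))|})
        atTop (𝓝 (0 : ℝ≥0∞)) := by
  obtain ⟨B0, hB0⟩ := hθbdd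
  obtain ⟨B, hB, hBn⟩ : ∃ B : ℝ, (∀ j i, |θstar j i| ≤ B) ∧ 0 ≤ B :=
    ⟨max B0 0, fun j i => (hB0 j i).trans (le_max_left _ _), le_max_right _ _⟩
  obtain ⟨δ, hδ, hδ1, hfix⟩ := fixed_point hκ hlam Pit
  have hae := ae_bound hB hW2
  rw [value_eq hlam hδ hκ (σ : ℝ) hae hfix]
  have hn0 : ∀ j, 0 < n j := by
    intro j
    rcases Nat.eq_zero_or_pos (n j) with h | h
    · have := hratio j
      rw [h] at this
      simp only [Nat.cast_zero, _root_.div_zero] at this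
      linarith
    · exact h
  have hd0 : ∀ j, 0 < d j := by
    intro j
    rcases Nat.eq_zero_or_pos (d j) with h | h
    · have := hratio j
      rw [h] at this
      simp only [Nat.cast_zero, zero_div] at this
      linarith
    · exact h
  set c : (j : ℕ) → Fin (d j) → ℝ := fun j k => v j k ^ 2 / lam with hc
  have hc0 : ∀ j k, 0 ≤ c j k := fun j k => by simp only [hc]; positivity
  have hB2 : ∀ j k, θstar j k ^ 2 ≤ B ^ 2 := fun j k => by
    rw [← sq_abs]
    exact pow_le_pow_left₀ (abs_nonneg _) (hB j k) 2
  -- limits of the empirical functionals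
  have hHd : Tendsto (fun j => Hd κ (c j) δ) atTop (𝓝 1) := by
    have h := (hW2 _ (pl2_uf hlam hδ.le)).const_mul κ |>.const_add δ
    rw [hfix] at h
    refine h.congr fun j => ?_
    unfold Hd
    simp only [hc, uf_c hlam hδ.le, one_div]
  have hGd : Tendsto (fun j => Gd ((σ : ℝ) ^ 2) (c j) (θstar j) δ) atTop
      (𝓝 (Gv (σ : ℝ) lam δ Pit)) := by
    have h := (hW2 _ (pl2_tuf hlam hδ.le hBn)).const_mul δ |>.const_add ((σ : ℝ) ^ 2 * δ)
    have e : ∫ p, min |p.2| B ^ 2 * uf lam δ p.1 ∂Pit = ∫ p, p.2 ^ 2 * uf lam δ p.1 ∂Pit := by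
      refine integral_congr_ae ?_
      filter_upwards [hae] with p hp
      rw [min_eq_left hp, sq_abs]
    rw [e] at h
    refine h.congr fun j => ?_
    unfold Gd
    congr 1
    rw [one_div, ← mul_assoc, mul_comm δ, mul_assoc, Finset.mul_sum]
    congr 1
    refine Finset.sum_congr rfl fun k _ => ?_
    simp only
    rw [min_eq_left (hB j k), sq_abs]
    simp only [uf, hc]
    ring
  obtain ⟨K, hK⟩ : ∃ K : ℝ, ∀ j, (d j : ℝ)⁻¹ * ∑ i, v j i ^ 2 ≤ K := by
    obtain ⟨K, hK⟩ := (hW2 _ pl2_sq).bddAbove_range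
    exact ⟨K, fun j => hK ⟨j, rfl⟩⟩
  set w : (j : ℕ) → Fin (d j) → ℝ := fun j k =>
    (1 / (d j : ℝ)) * (B ^ 2 + ((σ : ℝ) ^ 2 + B ^ 2) * κ * c j k) with hw
  have hw0 : ∀ j k, 0 ≤ w j k := fun j k => by
    have := hc0 j k
    simp only [hw]; positivity
  set W : ℝ := B ^ 2 + ((σ : ℝ) ^ 2 + B ^ 2) * κ / lam * K with hW
  have hwW : ∀ j, ∑ k, w j k ≤ W := by
    intro j
    have hdj : (0 : ℝ) < d j := by exact_mod_cast hd0 j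
    have e : ∑ k, w j k = B ^ 2 + ((σ : ℝ) ^ 2 + B ^ 2) * κ / lam *
        ((d j : ℝ)⁻¹ * ∑ i, v j i ^ 2) := by
      simp only [hw, hc]
      rw [← Finset.mul_sum, Finset.sum_add_distrib, ← Finset.mul_sum, ← Finset.sum_div]
      simp only [Finset.sum_const, Finset.card_univ, Fintype.card_fin, nsmul_eq_mul]
      generalize ∑ i, v j i ^ 2 = S
      field_simp
    rw [e, hW]
    have : 0 ≤ ((σ : ℝ) ^ 2 + B ^ 2) * κ / lam := by positivity
    have := mul_le_mul_of_nonneg_left (hK j) this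
    linarith
  set s : ℝ≥0 := σ ^ 2 with hs
  have hsc : (s : ℝ) = (σ : ℝ) ^ 2 := by simp [hs]
  set M : ℝ := Kq s + 4 * s * B ^ 2 + 4 * B ^ 4 + (2 * Kq 1 + 2) with hM
  have k1 := Kq_nonneg s
  have k2 := Kq_nonneg 1
  have k3 : 0 ≤ 4 * (s : ℝ) * B ^ 2 := by positivity
  have k4 : 0 ≤ 4 * B ^ 4 := by positivity
  have hM0 : 0 < M := by linarith
  intro ε hε
  -- deterministic error
  set η : ℕ → ℝ := fun j => ((σ : ℝ) ^ 2 + B ^ 2) * |Hd κ (c j) δ - 1| +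
    |Gd ((σ : ℝ) ^ 2) (c j) (θstar j) δ - Gv (σ : ℝ) lam δ Pit| with hη
  have hη0 : Tendsto η atTop (𝓝 0) := by
    have h1 := (hHd.sub_const 1).abs.const_mul ((σ : ℝ) ^ 2 + B ^ 2)
    have h2 := (hGd.sub_const (Gv (σ : ℝ) lam δ Pit)).abs
    simpa using h1.add h2
  have hev : ∀ᶠ j in atTop, η j < ε / 2 := hη0.eventually_lt_const (by positivity)
  have hlim : Tendsto (fun j => ENNReal.ofReal ((1 / (n j : ℝ)) * ((4 + W) * Real.sqrt (M * n j))) /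
      ENNReal.ofReal (ε / 2)) atTop (𝓝 0) := by
    have hnr : Tendsto (fun j => (n j : ℝ)) atTop atTop := tendsto_natCast_atTop_atTop.comp hn
    have h1 : Tendsto (fun j => ((4 + W) * Real.sqrt M) * (Real.sqrt (n j))⁻¹) atTop (𝓝 0) := by
      have := (tendsto_inv_atTop_zero.comp (Real.tendsto_sqrt_atTop.comp hnr)).const_mul
        ((4 + W) * Real.sqrt M)
      simpa using this
    have h2 : Tendsto (fun j => (1 / (n j : ℝ)) * ((4 + W) * Real.sqrt (M * n j))) atTop (𝓝 0) := by
      refine h1.congr fun j => ?_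
      have hnj : (0 : ℝ) < n j := by exact_mod_cast hn0 j
      have hq : 0 < Real.sqrt (n j) := Real.sqrt_pos.2 hnj
      rw [Real.sqrt_mul hM0.le]
      nth_rewrite 2 [← Real.mul_self_sqrt hnj.le]
      field_simp
    have h3 := ENNReal.tendsto_ofReal h2
    rw [ENNReal.ofReal_zero] at h3
    have h4 := ENNReal.Tendsto.div_const h3 (b := ENNReal.ofReal (ε / 2))
      (Or.inr (by simpa using hε))
    simpa using h4
  refine tendsto_of_tendsto_of_tendsto_of_le_of_le' tendsto_const_nhds hlim
    (Eventually.of_forall fun _ => zero_le) ?_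
  filter_upwards [hev] with j hj
  have ha0 : ∀ k, 0 ≤ (fun k => v j k ^ 2 / lam / n j) k := fun k => by
    simp only; positivity
  have hsub : {ω : (Fin (n j) → Fin (d j) → ℝ) × (Fin (n j) → ℝ) | ε ≤
            |(⨅ u : Fin (d j) → ℝ,
                ((1 / (n j : ℝ)) * ∑ i,
                  ((1 / Real.sqrt (d j)) * ∑ k, ω.1 i k * θstar j k + ω.2 i
                    - (1 / Real.sqrt (d j)) * ∑ k, ω.1 i k * (u k * v j k)) ^ 2
                  + (lam / (d j : ℝ)) * ∑ k, u k ^ 2))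
              - Gv (σ : ℝ) lam δ Pit|} ⊆
      {ω | ENNReal.ofReal (ε / 2) ≤ ENNReal.ofReal
        (errT s (fun k => v j k ^ 2 / lam / n j) (θstar j) (w j) ω)} := by
    intro ω hω
    simp only [Set.mem_ofPred_eq] at hω ⊢
    rw [ridge_form (hn0 j) (hd0 j) hlam] at hω
    have hb := det_bound (n := n j) (σ2 := (σ : ℝ) ^ 2) (B := B) (by positivity) (hn0 j) (hd0 j)
      (hratio j).symm (hc0 j) (a := fun k => v j k ^ 2 / lam / n j) (fun k => rfl) (hB2 j) hδ.le ω
    refine ENNReal.ofReal_le_ofReal ?_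
    rw [hsc]
    have h3 := abs_sub_le ((1 / (n j : ℝ)) * (dotProduct (zvec (θstar j) ω.1 + ω.2)
      (((Amat (fun k => v j k ^ 2 / lam / n j) ω.1)⁻¹).mulVec (zvec (θstar j) ω.1 + ω.2))))
      (Gd ((σ : ℝ) ^ 2) (c j) (θstar j) δ) (Gv (σ : ℝ) lam δ Pit)
    have hj' : ((σ : ℝ) ^ 2 + B ^ 2) * |Hd κ (c j) δ - 1| +
      |Gd ((σ : ℝ) ^ 2) (c j) (θstar j) δ - Gv (σ : ℝ) lam δ Pit| < ε / 2 := hj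
    have hb' : _ ≤ errT ((σ : ℝ) ^ 2) (fun k => v j k ^ 2 / lam / n j) (θstar j) (w j) ω +
      ((σ : ℝ) ^ 2 + B ^ 2) * |Hd κ (c j) δ - 1| := hb
    linarith
  refine (measure_mono hsub).trans ?_
  have hmeas := (meas_errT (n := n j) (θ := θstar j) (w := w j) s ha0).ennreal_ofReal
  have hbm : batchMeasure (n j) (d j) σ = (gmat (n j) (d j)).prod (gvec (n j) s) := rfl
  rw [hbm]
  refine (meas_ge_le_lintegral_div hmeas.aemeasurable (by simpa using hε)
    ENNReal.ofReal_ne_top).trans ?_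
  refine ENNReal.div_le_div_right ?_ _
  exact errT_bound s (hn0 j) (hd0 j) ha0 (hw0 j) (hB j) hM0 (by linarith) (by linarith)
    (by linarith) (by linarith) (hwW j)
end
end

section
/- Let σ, λ, κ > 0 and let Π be a probability distribution on ℝ² under which V ≠ 0 almost surely and E[Θ² + V²] < ∞. Define f(τ, β) = τσ²/β + τβ(1 − κ) − τ² + τλ E_{(V,Θ)~Π}[(Θ² + β²κ)/(τV² + βλ)] for τ ≥ 0 and β > 0. Then: (i) for each fixed β > 0, the map τ ↦ f(τ, β) is strongly concave on [0, ∞); (ii) for each fixed τ > 0, the map β ↦ f(τ, β) has a unique critical point on (0, ∞), characterized as the unique β > 0 satisfying β² = σ² + E[(ÛV − Θ)²], where Û = τV(Θ − β√κ G)/(τV² + βλ) and G ~ N(0,1) is independent of (V, Θ); and (iii) the max–min problem max_{τ ≥ 0} min_{β > 0} f(τ, β) admits a unique saddle point (τ̂, β̂) with β̂ > 0. -/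
open MeasureTheory ProbabilityTheory

noncomputable section

lemma int_sq {Pit : Measure (ℝ × ℝ)} (hmom : Integrable (fun p : ℝ × ℝ => p.2 ^ 2 + p.1 ^ 2) Pit) :
    Integrable (fun p : ℝ × ℝ => p.2 ^ 2) Pit ∧ Integrable (fun p : ℝ × ℝ => p.1 ^ 2) Pit := by
  constructor
  · refine hmom.mono' (by fun_prop) (ae_of_all _ fun p => ?_)
    rw [Real.norm_of_nonneg (by positivity)]
    nlinarith [sq_nonneg p.1]
  · refine hmom.mono' (by fun_prop) (ae_of_all _ fun p => ?_)
    rw [Real.norm_of_nonneg (by positivity)]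
    nlinarith [sq_nonneg p.2]

lemma den_pos {lam τ β : ℝ} (hlam : 0 < lam) (hτ : 0 ≤ τ) (hβ : 0 < β) (v : ℝ) :
    0 < τ * v ^ 2 + β * lam := by positivity

lemma int_F {lam κ : ℝ} (hlam : 0 < lam) (hκ : 0 < κ)
    {Pit : Measure (ℝ × ℝ)} [IsProbabilityMeasure Pit]
    (hmom : Integrable (fun p : ℝ × ℝ => p.2 ^ 2 + p.1 ^ 2) Pit)
    {τ β : ℝ} (hτ : 0 ≤ τ) (hβ : 0 < β) :
    Integrable (fun p : ℝ × ℝ => (p.2 ^ 2 + β ^ 2 * κ) / (τ * p.1 ^ 2 + β * lam)) Pit := by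
  have hb : Integrable (fun p : ℝ × ℝ => (p.2 ^ 2 + β ^ 2 * κ) / (β * lam)) Pit :=
    ((int_sq hmom).1.add (integrable_const _)).div_const _
  refine hb.mono' (Measurable.aestronglyMeasurable (by fun_prop)) (ae_of_all _ fun p => ?_)
  have := den_pos hlam hτ hβ p.1
  rw [Real.norm_of_nonneg (by positivity)]
  gcongr
  have : 0 ≤ τ * p.1 ^ 2 := by positivity
  linarith

lemma conc {σ lam κ : ℝ} (hlam : 0 < lam) (hκ : 0 < κ)
    {Pit : Measure (ℝ × ℝ)} [IsProbabilityMeasure Pit]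
    (hmom : Integrable (fun p : ℝ × ℝ => p.2 ^ 2 + p.1 ^ 2) Pit) {β : ℝ} (hβ : 0 < β) :
    StrongConcaveOn (Set.Ici (0 : ℝ)) 2 (fun τ => scalarObj σ lam κ Pit τ β) := by
  rw [strongConcaveOn_iff_convex]
  refine ⟨convex_Ici 0, ?_⟩
  intro x hx y hy a b ha hb hab
  have hx : 0 ≤ x := hx
  have hy : 0 ≤ y := hy
  have hz : 0 ≤ a * x + b * y := by positivity
  have key : a * (x * ∫ p, (p.2 ^ 2 + β ^ 2 * κ) / (x * p.1 ^ 2 + β * lam) ∂Pit)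
      + b * (y * ∫ p, (p.2 ^ 2 + β ^ 2 * κ) / (y * p.1 ^ 2 + β * lam) ∂Pit)
      ≤ (a * x + b * y) *
        ∫ p, (p.2 ^ 2 + β ^ 2 * κ) / ((a * x + b * y) * p.1 ^ 2 + β * lam) ∂Pit := by
    simp only [← integral_const_mul]
    rw [← integral_add]
    · apply integral_mono
      · exact (((int_F hlam hκ hmom hx hβ).const_mul x).const_mul a).add
          (((int_F hlam hκ hmom hy hβ).const_mul y).const_mul b)
      · exact (int_F hlam hκ hmom hz hβ).const_mul _
      · intro p
        have h1 := den_pos hlam hx hβ p.1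
        have h2 := den_pos hlam hy hβ p.1
        have h3 := den_pos hlam hz hβ p.1
        have hb' : b = 1 - a := by linarith
        have hN : 0 ≤ p.2 ^ 2 + β ^ 2 * κ := by positivity
        have hd : 0 < β * lam := by positivity
        have hv : 0 ≤ p.1 ^ 2 := by positivity
        dsimp only
        generalize p.2 ^ 2 + β ^ 2 * κ = N at *
        generalize p.1 ^ 2 = v at *
        generalize β * lam = d at *
        have : (a * x + b * y) * (N / ((a * x + b * y) * v + d))
          - (a * (x * (N / (x * v + d))) + b * (y * (N / (y * v + d))))
          = N * (a * b * d * v * (x - y) ^ 2) /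
            (((a * x + b * y) * v + d) * (x * v + d) * (y * v + d)) := by
          subst hb'
          field_simp
          ring
        have h4 : 0 ≤ N * (a * b * d * v * (x - y) ^ 2) /
            (((a * x + b * y) * v + d) * (x * v + d) * (y * v + d)) := by positivity
        linarith
    · exact ((int_F hlam hκ hmom hx hβ).const_mul x).const_mul a
    · exact ((int_F hlam hκ hmom hy hβ).const_mul y).const_mul b
  simp only [scalarObj, smul_eq_mul, Real.norm_eq_abs, sq_abs]
  have := mul_le_mul_of_nonneg_left key hlam.le
  have e : b = 1 - a := by linarith
  have e1 : (a * x + b * y) * σ ^ 2 / β = a * (x * σ ^ 2 / β) + b * (y * σ ^ 2 / β) := by ring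
  rw [e1]
  linarith

/-- the integral in the derivative -/
def HH (lam κ : ℝ) (Pit : Measure (ℝ × ℝ)) (τ β : ℝ) : ℝ :=
  ∫ p, (lam ^ 2 * p.2 ^ 2 + κ * (τ * p.1 ^ 2) ^ 2) / (τ * p.1 ^ 2 + β * lam) ^ 2 ∂Pit

lemma HH_int {lam κ : ℝ} (hlam : 0 < lam) (hκ : 0 < κ)
    {Pit : Measure (ℝ × ℝ)} [IsProbabilityMeasure Pit]
    (hmom : Integrable (fun p : ℝ × ℝ => p.2 ^ 2 + p.1 ^ 2) Pit)
    {τ β : ℝ} (hτ : 0 ≤ τ) (hβ : 0 < β) :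
    Integrable (fun p : ℝ × ℝ => (lam ^ 2 * p.2 ^ 2 + κ * (τ * p.1 ^ 2) ^ 2) /
      (τ * p.1 ^ 2 + β * lam) ^ 2) Pit := by
  have hb : Integrable (fun p : ℝ × ℝ => lam ^ 2 * p.2 ^ 2 / (β * lam) ^ 2 + κ) Pit :=
    (((int_sq hmom).1.const_mul _).div_const _).add (integrable_const _)
  refine hb.mono' (Measurable.aestronglyMeasurable (by fun_prop)) (ae_of_all _ fun p => ?_)
  have := den_pos hlam hτ hβ p.1
  rw [Real.norm_of_nonneg (by positivity), add_div]
  have h0 : 0 ≤ τ * p.1 ^ 2 := by positivity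
  have hd : 0 < β * lam := by positivity
  gcongr
  · linarith
  · rw [div_le_iff₀ (by positivity)]
    gcongr
    linarith

lemma HH_le {lam κ : ℝ} (hlam : 0 < lam) (hκ : 0 < κ)
    {Pit : Measure (ℝ × ℝ)} [IsProbabilityMeasure Pit]
    (hmom : Integrable (fun p : ℝ × ℝ => p.2 ^ 2 + p.1 ^ 2) Pit)
    {τ β : ℝ} (hτ : 0 ≤ τ) (hβ : 0 < β) :
    HH lam κ Pit τ β ≤ (∫ p, p.2 ^ 2 ∂Pit) / β ^ 2 + κ * τ / (β * lam) * ∫ p, p.1 ^ 2 ∂Pit := by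
  rw [HH, ← integral_const_mul, ← integral_div, ← integral_add]
  · refine integral_mono (HH_int hlam hκ hmom hτ hβ)
      (((int_sq hmom).1.div_const _).add ((int_sq hmom).2.const_mul _)) fun p => ?_
    have := den_pos hlam hτ hβ p.1
    dsimp only
    rw [add_div]
    have h0 : 0 ≤ τ * p.1 ^ 2 := by positivity
    have hd : 0 < β * lam := by positivity
    apply add_le_add
    · rw [div_le_div_iff₀ (by positivity) (by positivity)]
      have : (β * lam) ^ 2 ≤ (τ * p.1 ^ 2 + β * lam) ^ 2 := by gcongr; linarith
      nlinarith [mul_le_mul_of_nonneg_left this (sq_nonneg p.2)]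
    · have e : κ * τ / (β * lam) * p.1 ^ 2 = κ * (τ * p.1 ^ 2) / (β * lam) := by ring
      rw [e]
      generalize τ * p.1 ^ 2 = a at *
      generalize β * lam = d at *
      rw [div_le_div_iff₀ (by positivity) (by positivity)]
      have : a * d ≤ (a + d) ^ 2 := by nlinarith
      nlinarith [mul_le_mul_of_nonneg_left this (mul_nonneg hκ.le h0)]
  · exact (int_sq hmom).1.div_const _
  · exact (int_sq hmom).2.const_mul _

lemma HH_nonneg {lam κ : ℝ} (hκ : 0 < κ)
    {Pit : Measure (ℝ × ℝ)} {τ β : ℝ} : 0 ≤ HH lam κ Pit τ β :=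
  integral_nonneg fun p => by positivity

lemma HH_anti {lam κ : ℝ} (hlam : 0 < lam) (hκ : 0 < κ)
    {Pit : Measure (ℝ × ℝ)} [IsProbabilityMeasure Pit]
    (hmom : Integrable (fun p : ℝ × ℝ => p.2 ^ 2 + p.1 ^ 2) Pit)
    {τ β β' : ℝ} (hτ : 0 ≤ τ) (hβ : 0 < β) (h : β ≤ β') :
    HH lam κ Pit τ β' ≤ HH lam κ Pit τ β := by
  refine integral_mono (HH_int hlam hκ hmom hτ (hβ.trans_le h))
    (HH_int hlam hκ hmom hτ hβ) fun p => ?_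
  have := den_pos hlam hτ hβ p.1
  dsimp only
  gcongr

lemma hasDeriv {σ lam κ : ℝ} (hlam : 0 < lam) (hκ : 0 < κ)
    {Pit : Measure (ℝ × ℝ)} [IsProbabilityMeasure Pit]
    (hmom : Integrable (fun p : ℝ × ℝ => p.2 ^ 2 + p.1 ^ 2) Pit)
    {τ β : ℝ} (hτ : 0 ≤ τ) (hβ : 0 < β) :
    HasDerivAt (fun β' => scalarObj σ lam κ Pit τ β')
      (τ * (1 - σ ^ 2 / β ^ 2 - HH lam κ Pit τ β)) β := by
  have hI := hasDerivAt_integral_of_dominated_loc_of_deriv_le (μ := Pit)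
    (F := fun (x : ℝ) (p : ℝ × ℝ) => (p.2 ^ 2 + x ^ 2 * κ) / (τ * p.1 ^ 2 + x * lam))
    (F' := fun (x : ℝ) (p : ℝ × ℝ) => (2 * x * κ * (τ * p.1 ^ 2 + x * lam)
      - (p.2 ^ 2 + x ^ 2 * κ) * lam) / (τ * p.1 ^ 2 + x * lam) ^ 2)
    (bound := fun p => 3 * κ / lam + p.2 ^ 2 / (lam * (β / 2) ^ 2))
    (s := Set.Ioi (β / 2)) (x₀ := β)
    (Ioi_mem_nhds (by linarith))
    (Filter.Eventually.of_forall fun x => Measurable.aestronglyMeasurable (by fun_prop))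
    (int_F hlam hκ hmom hτ hβ) (Measurable.aestronglyMeasurable (by fun_prop))
    (ae_of_all _ ?_) ((integrable_const _).add ((int_sq hmom).1.div_const _))
    (ae_of_all _ ?_)
  · obtain ⟨hI1, hI2⟩ := hI
    have h1 : HasDerivAt (fun x : ℝ => τ * σ ^ 2 / x + τ * x * (1 - κ) - τ ^ 2)
        (τ * σ ^ 2 * (-(β ^ 2)⁻¹) + τ * (1 - κ)) β := by
      have := ((((hasDerivAt_inv hβ.ne').const_mul (τ * σ ^ 2)).add
        (((hasDerivAt_id β).const_mul τ).mul_const (1 - κ))).sub_const (τ ^ 2))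
      refine this.congr_deriv (by simp) |>.congr_of_eventuallyEq ?_
      exact Filter.Eventually.of_forall fun x => by simp [div_eq_mul_inv]
    refine (h1.add (hI2.const_mul (τ * lam))).congr_deriv ?_
    have : HH lam κ Pit τ β = κ - lam * ∫ p : ℝ × ℝ, (2 * β * κ * (τ * p.1 ^ 2 + β * lam)
      - (p.2 ^ 2 + β ^ 2 * κ) * lam) / (τ * p.1 ^ 2 + β * lam) ^ 2 ∂Pit := by
      have e : κ = ∫ p, κ ∂Pit := by simp
      conv_rhs => rw [e]
      rw [← integral_const_mul, ← integral_sub (integrable_const _), HH]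
      · congr 1
        ext p
        have := den_pos hlam hτ hβ p.1
        simp only [integral_const, probReal_univ, one_smul]
        field_simp
        ring
      · simpa using hI1.const_mul lam
    rw [this]
    field_simp
    ring
  · intro p x hx
    have hx : β / 2 < x := hx
    have hx0 : 0 < x := by linarith
    have := den_pos hlam hτ hx0 p.1
    have h0 : 0 ≤ τ * p.1 ^ 2 := by positivity
    have hd : 0 < x * lam := by positivity
    rw [sub_div]
    refine (norm_sub_le _ _).trans ?_
    rw [Real.norm_of_nonneg (by positivity), Real.norm_of_nonneg (by positivity)]
    have t1 : 2 * x * κ * (τ * p.1 ^ 2 + x * lam) / (τ * p.1 ^ 2 + x * lam) ^ 2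
        ≤ 2 * κ / lam := by
      rw [div_le_div_iff₀ (by positivity) hlam]
      have : (x * lam) * (τ * p.1 ^ 2 + x * lam) ≤ (τ * p.1 ^ 2 + x * lam) ^ 2 := by nlinarith
      nlinarith [mul_le_mul_of_nonneg_left this hκ.le]
    have t2 : (p.2 ^ 2 + x ^ 2 * κ) * lam / (τ * p.1 ^ 2 + x * lam) ^ 2 ≤
        (p.2 ^ 2 + x ^ 2 * κ) * lam / (x * lam) ^ 2 := by
      gcongr
      linarith
    have t3 : (p.2 ^ 2 + x ^ 2 * κ) * lam / (x * lam) ^ 2 = κ / lam + p.2 ^ 2 / (lam * x ^ 2) := by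
      field_simp
      ring
    have t4 : p.2 ^ 2 / (lam * x ^ 2) ≤ p.2 ^ 2 / (lam * (β / 2) ^ 2) := by
      gcongr
    have t5 : 3 * κ / lam = 2 * κ / lam + κ / lam := by ring
    linarith
  · intro p x hx
    have hx : β / 2 < x := hx
    have hx0 : 0 < x := by linarith
    have := den_pos hlam hτ hx0 p.1
    have n1 : HasDerivAt (fun x : ℝ => p.2 ^ 2 + x ^ 2 * κ) (2 * x * κ) x := by
      simpa using (((hasDerivAt_id x).pow 2).mul_const κ).const_add (p.2 ^ 2)
    have n2 : HasDerivAt (fun x : ℝ => τ * p.1 ^ 2 + x * lam) lam x := by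
      simpa using ((hasDerivAt_id x).mul_const lam).const_add (τ * p.1 ^ 2)
    exact n1.div n2 this.ne'

lemma gauss_eq {lam κ : ℝ} (hlam : 0 < lam) (hκ : 0 < κ)
    {Pit : Measure (ℝ × ℝ)} [IsProbabilityMeasure Pit]
    (hmom : Integrable (fun p : ℝ × ℝ => p.2 ^ 2 + p.1 ^ 2) Pit)
    {τ β : ℝ} (hτ : 0 ≤ τ) (hβ : 0 < β) :
    ∫ q, (τ * q.1.1 * (q.1.2 - β * Real.sqrt κ * q.2) / (τ * q.1.1 ^ 2 + β * lam)
                * q.1.1 - q.1.2) ^ 2 ∂(Pit.prod (gaussianReal 0 1)) = β ^ 2 * HH lam κ Pit τ β := by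
  have g1 : ∫ x, x ∂(gaussianReal 0 1) = 0 := by simp
  have ml : MemLp id 2 (gaussianReal 0 1) := by simpa using memLp_id_gaussianReal (μ := 0) (v := 1) 2
  have gi2 : Integrable (fun x : ℝ => x ^ 2) (gaussianReal 0 1) := ml.integrable_sq
  have gi1 : Integrable (fun x : ℝ => x) (gaussianReal 0 1) := ml.integrable (by norm_num)
  have g2 : ∫ x, x ^ 2 ∂(gaussianReal 0 1) = 1 := by
    have := variance_eq_sub ml
    rw [variance_id_gaussianReal] at this
    simpa using this.symm
  set D : ℝ × ℝ → ℝ := fun p => τ * p.1 ^ 2 + β * lam with hD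
  have hDp : ∀ p, 0 < D p := fun p => den_pos hlam hτ hβ p.1
  have hDm : Measurable D := by fun_prop
  set A : ℝ × ℝ → ℝ := fun p => (β * lam * p.2 / D p) with hA
  set B : ℝ × ℝ → ℝ := fun p => (τ * p.1 ^ 2 * β * Real.sqrt κ / D p) with hB
  have hAm : Measurable A := by fun_prop
  have hBm : Measurable B := by fun_prop
  have h0 : ∀ p : ℝ × ℝ, 0 ≤ τ * p.1 ^ 2 := fun p => by positivity
  have hd : 0 < β * lam := by positivity
  have hA2 : MemLp A 2 Pit := by
    rw [memLp_two_iff_integrable_sq hAm.aestronglyMeasurable]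
    refine (int_sq hmom).1.mono' (by fun_prop) (ae_of_all _ fun p => ?_)
    rw [Real.norm_of_nonneg (by positivity)]
    have := hDp p
    simp only [hA]
    rw [div_pow, div_le_iff₀ (by positivity), mul_pow, mul_comm]
    gcongr
    simp only [hD]; linarith [h0 p]
  have hB2 : MemLp B 2 Pit := by
    refine MemLp.of_bound hBm.aestronglyMeasurable (β * Real.sqrt κ) (ae_of_all _ fun p => ?_)
    have := hDp p
    simp only [hB]
    rw [Real.norm_of_nonneg (by positivity), div_le_iff₀ this, mul_assoc, mul_comm]
    gcongr
    simp only [hD]; linarith [h0 p]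
  have iA := hA2.integrable_sq
  have iB := hB2.integrable_sq
  have iAB : Integrable (fun p => 2 * (A p * B p)) Pit := (hA2.integrable_mul hB2).const_mul 2
  have e : ∀ q : (ℝ × ℝ) × ℝ, (τ * q.1.1 * (q.1.2 - β * Real.sqrt κ * q.2) /
      (τ * q.1.1 ^ 2 + β * lam) * q.1.1 - q.1.2) ^ 2 =
      (A q.1 ^ 2 * 1 + 2 * (A q.1 * B q.1) * q.2) + B q.1 ^ 2 * q.2 ^ 2 := by
    intro q
    have := hDp q.1
    simp only [hA, hB, hD] at this ⊢
    field_simp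
    ring
  simp_rw [e]
  have j1 : Integrable (fun q : (ℝ × ℝ) × ℝ => A q.1 ^ 2 * (1 : ℝ)) (Pit.prod (gaussianReal 0 1)) :=
    iA.mul_prod (g := fun _ : ℝ => (1 : ℝ)) (integrable_const _)
  have j2 := iAB.mul_prod gi1
  have j3 := iB.mul_prod gi2
  have j12 : Integrable (fun q : (ℝ × ℝ) × ℝ => A q.1 ^ 2 * (1 : ℝ) + 2 * (A q.1 * B q.1) * q.2)
    (Pit.prod (gaussianReal 0 1)) := j1.add j2
  rw [integral_add j12 j3, integral_add j1 j2,
    integral_prod_mul (fun p => A p ^ 2) (fun _ : ℝ => (1 : ℝ)),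
    integral_prod_mul (fun p => 2 * (A p * B p)) (fun x : ℝ => x),
    integral_prod_mul (fun p => B p ^ 2) (fun x : ℝ => x ^ 2), g1, g2]
  simp only [integral_const, probReal_univ, one_smul, mul_one, mul_zero, add_zero]
  rw [← integral_add iA iB, HH, ← integral_const_mul]
  congr 1
  ext p
  have := hDp p
  have sq := Real.sq_sqrt hκ.le
  simp only [hA, hB, hD] at this ⊢
  field_simp
  rw [sq]

lemma deriv_strictMono {σ lam κ : ℝ} (hσ : 0 < σ) (hlam : 0 < lam) (hκ : 0 < κ)
    {Pit : Measure (ℝ × ℝ)} [IsProbabilityMeasure Pit]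
    (hmom : Integrable (fun p : ℝ × ℝ => p.2 ^ 2 + p.1 ^ 2) Pit)
    {τ x y : ℝ} (hτ : 0 < τ) (hx : 0 < x) (hxy : x < y) :
    τ * (1 - σ ^ 2 / x ^ 2 - HH lam κ Pit τ x) < τ * (1 - σ ^ 2 / y ^ 2 - HH lam κ Pit τ y) := by
  have h1 := HH_anti hlam hκ hmom hτ.le hx hxy.le
  have h2 : σ ^ 2 / y ^ 2 < σ ^ 2 / x ^ 2 := by gcongr
  apply mul_lt_mul_of_pos_left _ hτ
  linarith

lemma strictConv {σ lam κ : ℝ} (hσ : 0 < σ) (hlam : 0 < lam) (hκ : 0 < κ)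
    {Pit : Measure (ℝ × ℝ)} [IsProbabilityMeasure Pit]
    (hmom : Integrable (fun p : ℝ × ℝ => p.2 ^ 2 + p.1 ^ 2) Pit)
    {τ : ℝ} (hτ : 0 < τ) :
    StrictConvexOn ℝ (Set.Ioi 0) (fun β => scalarObj σ lam κ Pit τ β) := by
  refine StrictMonoOn.strictConvexOn_of_deriv (convex_Ioi 0)
    (fun x hx => (hasDeriv hlam hκ hmom hτ.le hx).continuousAt.continuousWithinAt) ?_
  rw [interior_Ioi]
  intro x hx y hy hxy
  rw [(hasDeriv hlam hκ hmom hτ.le hx).deriv, (hasDeriv hlam hκ hmom hτ.le hy).deriv]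
  exact deriv_strictMono hσ hlam hκ hmom hτ hx hxy

lemma exists_B {σ lam κ : ℝ} (hσ : 0 < σ) (hlam : 0 < lam) (hκ : 0 < κ)
    {Pit : Measure (ℝ × ℝ)} [IsProbabilityMeasure Pit]
    (hmom : Integrable (fun p : ℝ × ℝ => p.2 ^ 2 + p.1 ^ 2) Pit)
    {T : ℝ} (hT : 0 < T) : ∃ B, σ < B ∧ ∀ τ, 0 < τ → τ ≤ T →
      ∃ b, σ ≤ b ∧ b ≤ B ∧ τ * (1 - σ ^ 2 / b ^ 2 - HH lam κ Pit τ b) = 0 := by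
  set E2 := ∫ p, p.2 ^ 2 ∂Pit with hE2
  set E1 := ∫ p, p.1 ^ 2 ∂Pit with hE1
  have h2 : 0 ≤ E2 := integral_nonneg fun p => by positivity
  have h1 : 0 ≤ E1 := integral_nonneg fun p => by positivity
  set c := κ * T / lam * E1 with hc
  have hc0 : 0 ≤ c := by positivity
  refine ⟨1 + σ + (σ ^ 2 + E2 + c), by nlinarith, fun τ hτ hτT => ?_⟩
  set B := 1 + σ + (σ ^ 2 + E2 + c) with hB
  have hB1 : 1 ≤ B := by nlinarith
  have hB0 : 0 < B := by linarith
  have hσB : σ ≤ B := by nlinarith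
  have hHB : HH lam κ Pit τ B ≤ E2 / B ^ 2 + c / B := by
    refine (HH_le hlam hκ hmom hτ.le hB0).trans ?_
    rw [← hE2, ← hE1]
    have : κ * τ / (B * lam) * E1 ≤ κ * T / (B * lam) * E1 := by gcongr
    have e : κ * T / (B * lam) * E1 = c / B := by rw [hc]; field_simp
    linarith
  have := exists_hasDerivWithinAt_eq_of_ge_of_le (f := fun β => scalarObj σ lam κ Pit τ β)
    (f' := fun b => τ * (1 - σ ^ 2 / b ^ 2 - HH lam κ Pit τ b)) (m := 0) hσB
    (fun x hx => (hasDeriv hlam hκ hmom hτ.le (hσ.trans_le hx.1)).hasDerivWithinAt) ?_ ?_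
  · obtain ⟨b, hb, hb'⟩ := this
    exact ⟨b, hb.1, hb.2, hb'⟩
  · have e : σ ^ 2 / σ ^ 2 = 1 := by field_simp
    have := HH_nonneg (lam := lam) hκ (Pit := Pit) (τ := τ) (β := σ)
    rw [e]
    nlinarith
  · apply mul_nonneg hτ.le
    have t1 : σ ^ 2 / B ^ 2 + E2 / B ^ 2 + c / B ≤ 1 := by
      rw [← add_div, div_add_div _ _ (by positivity) (by positivity),
        div_le_one (by positivity)]
      have k1 : σ ^ 2 + E2 + c ≤ B := by rw [hB]; linarith
      have k2 : 0 ≤ σ ^ 2 + E2 := by positivity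
      have k3 : σ ^ 2 + E2 + B * c ≤ B ^ 2 := by nlinarith
      nlinarith [mul_le_mul_of_nonneg_left k3 hB0.le]
    linarith

lemma crit_min {σ lam κ : ℝ} (hσ : 0 < σ) (hlam : 0 < lam) (hκ : 0 < κ)
    {Pit : Measure (ℝ × ℝ)} [IsProbabilityMeasure Pit]
    (hmom : Integrable (fun p : ℝ × ℝ => p.2 ^ 2 + p.1 ^ 2) Pit)
    {τ b β : ℝ} (hτ : 0 < τ) (hb : 0 < b)
    (hcr : τ * (1 - σ ^ 2 / b ^ 2 - HH lam κ Pit τ b) = 0) (hβ : 0 < β) :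
    scalarObj σ lam κ Pit τ b ≤ scalarObj σ lam κ Pit τ β := by
  have hd := hasDeriv (σ := σ) hlam hκ hmom hτ.le hb
  rw [hcr] at hd
  have hc := (strictConv hσ hlam hκ hmom hτ).convexOn
  rcases lt_trichotomy b β with h | h | h
  · have := hc.le_slope_of_hasDerivAt hb hβ h hd
    rw [slope_def_field, le_div_iff₀ (by linarith)] at this
    linarith
  · rw [h]
  · have := hc.slope_le_of_hasDerivAt hβ hb h hd
    rw [slope_def_field, div_le_iff₀ (by linarith)] at this
    linarith

lemma cont_tau {σ lam κ : ℝ} (hlam : 0 < lam) (hκ : 0 < κ)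
    {Pit : Measure (ℝ × ℝ)} [IsProbabilityMeasure Pit]
    (hmom : Integrable (fun p : ℝ × ℝ => p.2 ^ 2 + p.1 ^ 2) Pit) {β : ℝ} (hβ : 0 < β) :
    ContinuousOn (fun τ => scalarObj σ lam κ Pit τ β) (Set.Ici 0) := by
  have hb : Integrable (fun p : ℝ × ℝ => (p.2 ^ 2 + β ^ 2 * κ) / (β * lam)) Pit :=
    ((int_sq hmom).1.add (integrable_const _)).div_const _
  have : ContinuousOn (fun τ => ∫ p, (p.2 ^ 2 + β ^ 2 * κ) / (τ * p.1 ^ 2 + β * lam) ∂Pit)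
      (Set.Ici 0) := by
    refine continuousOn_of_dominated (fun τ hτ => (int_F hlam hκ hmom hτ hβ).aestronglyMeasurable)
      (fun τ hτ => ae_of_all _ fun p => ?_) hb (ae_of_all _ fun p => ?_)
    · have hτ : 0 ≤ τ := hτ
      have := den_pos hlam hτ hβ p.1
      rw [Real.norm_of_nonneg (by positivity)]
      gcongr
      have : 0 ≤ τ * p.1 ^ 2 := by positivity
      linarith
    · refine ContinuousOn.div (by fun_prop) (by fun_prop) fun τ hτ => ?_
      exact (den_pos hlam hτ hβ p.1).ne'
  unfold scalarObj
  fun_prop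

lemma obj_zero {σ lam κ : ℝ} {Pit : Measure (ℝ × ℝ)} {β : ℝ} : scalarObj σ lam κ Pit 0 β = 0 := by
  simp [scalarObj]

lemma obj_le {σ lam κ : ℝ} (hlam : 0 < lam) (hκ : 0 < κ)
    {Pit : Measure (ℝ × ℝ)} [IsProbabilityMeasure Pit]
    (hmom : Integrable (fun p : ℝ × ℝ => p.2 ^ 2 + p.1 ^ 2) Pit) {τ β : ℝ} (hτ : 0 ≤ τ)
    (hβ : 0 < β) : scalarObj σ lam κ Pit τ β ≤
      τ * (σ ^ 2 / β + β + (∫ p, p.2 ^ 2 ∂Pit) / β - τ) := by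
  have hi : Integrable (fun p : ℝ × ℝ => (p.2 ^ 2 + β ^ 2 * κ) / (β * lam)) Pit :=
    ((int_sq hmom).1.add (integrable_const _)).div_const _
  have h : ∫ p, (p.2 ^ 2 + β ^ 2 * κ) / (τ * p.1 ^ 2 + β * lam) ∂Pit ≤
      ((∫ p, p.2 ^ 2 ∂Pit) + β ^ 2 * κ) / (β * lam) := by
    have e : ∫ p : ℝ × ℝ, (p.2 ^ 2 + β ^ 2 * κ) / (β * lam) ∂Pit =
        ((∫ p, p.2 ^ 2 ∂Pit) + β ^ 2 * κ) / (β * lam) := by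
      rw [integral_div, integral_add (int_sq hmom).1 (integrable_const _)]
      simp
    rw [← e]
    refine integral_mono (int_F hlam hκ hmom hτ hβ) hi fun p => ?_
    dsimp only
    gcongr
    have : 0 ≤ τ * p.1 ^ 2 := by positivity
    linarith
  have h' := mul_le_mul_of_nonneg_left h (mul_nonneg hτ hlam.le)
  have e : τ * lam * (((∫ p, p.2 ^ 2 ∂Pit) + β ^ 2 * κ) / (β * lam)) =
    τ * ((∫ p, p.2 ^ 2 ∂Pit) / β + β * κ) := by field_simp
  rw [e] at h'
  unfold scalarObj
  have e2 : τ * σ ^ 2 / β = τ * (σ ^ 2 / β) := by ring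
  rw [e2]
  linarith

/-- `f(τ,β) > 0` for some `τ > 0`. -/
lemma exists_pos {σ lam κ : ℝ} (hσ : 0 < σ) (hlam : 0 < lam) (hκ : 0 < κ)
    {Pit : Measure (ℝ × ℝ)} [IsProbabilityMeasure Pit]
    (hmom : Integrable (fun p : ℝ × ℝ => p.2 ^ 2 + p.1 ^ 2) Pit) {β : ℝ}
    (hβ : 0 < β) : ∃ τ > 0, 0 < scalarObj σ lam κ Pit τ β := by
  -- `h τ = f(τ,β)/τ` is continuous at `0` with positive value
  set h : ℝ → ℝ := fun τ => σ ^ 2 / β + β * (1 - κ) - τ +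
    lam * ∫ p, (p.2 ^ 2 + β ^ 2 * κ) / (τ * p.1 ^ 2 + β * lam) ∂Pit with hh
  have hlow : ∀ τ, 0 ≤ τ → σ ^ 2 / β + β - τ * (1 + κ * (∫ p, p.1 ^ 2 ∂Pit) / lam) ≤ h τ := by
    intro τ hτ
    have k : β * κ - τ * (κ * (∫ p, p.1 ^ 2 ∂Pit) / lam) ≤
        lam * ∫ p, (p.2 ^ 2 + β ^ 2 * κ) / (τ * p.1 ^ 2 + β * lam) ∂Pit := by
      have e : β * κ - τ * (κ * (∫ p, p.1 ^ 2 ∂Pit) / lam) =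
          ∫ p : ℝ × ℝ, (β * κ - τ * κ / lam * p.1 ^ 2) ∂Pit := by
        rw [integral_sub (integrable_const _) ((int_sq hmom).2.const_mul _),
          integral_const_mul (τ * κ / lam) (fun p : ℝ × ℝ => p.1 ^ 2)]
        simp
        ring
      rw [e, ← integral_const_mul]
      refine integral_mono ((integrable_const _).sub ((int_sq hmom).2.const_mul _))
        ((int_F hlam hκ hmom hτ hβ).const_mul _) fun p => ?_
      have h1 := den_pos hlam hτ hβ p.1
      dsimp only
      rw [← sub_nonneg]
      have : lam * ((p.2 ^ 2 + β ^ 2 * κ) / (τ * p.1 ^ 2 + β * lam)) -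
        (β * κ - τ * κ / lam * p.1 ^ 2) =
        (lam * p.2 ^ 2 + κ * (τ * p.1 ^ 2) ^ 2 / lam) / (τ * p.1 ^ 2 + β * lam) := by
        field_simp
        ring
      rw [this]
      positivity
    simp only [hh]
    linarith
  set C := 1 + κ * (∫ p, p.1 ^ 2 ∂Pit) / lam with hC
  have hE : 0 ≤ ∫ p, p.1 ^ 2 ∂Pit := integral_nonneg fun p => by positivity
  have hC0 : 0 < C := by positivity
  refine ⟨β / (C), by positivity, ?_⟩
  have h1 := hlow (β / C) (by positivity)
  rw [div_mul_cancel₀ _ hC0.ne'] at h1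
  have h2 : 0 < h (β / C) := lt_of_lt_of_le (by ring_nf; positivity) h1
  have e : scalarObj σ lam κ Pit (β / C) β = β / C * h (β / C) := by
    simp only [scalarObj, hh]; ring
  rw [e]
  positivity

lemma exists_saddle {σ lam κ : ℝ} (hσ : 0 < σ) (hlam : 0 < lam) (hκ : 0 < κ)
    {Pit : Measure (ℝ × ℝ)} [IsProbabilityMeasure Pit]
    (hmom : Integrable (fun p : ℝ × ℝ => p.2 ^ 2 + p.1 ^ 2) Pit) :
    ∃ pt : ℝ × ℝ, 0 ≤ pt.1 ∧ 0 < pt.2 ∧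
      (∀ τ ≥ (0 : ℝ), scalarObj σ lam κ Pit τ pt.2 ≤ scalarObj σ lam κ Pit pt.1 pt.2) ∧
      (∀ β > (0 : ℝ), scalarObj σ lam κ Pit pt.1 pt.2 ≤ scalarObj σ lam κ Pit pt.1 β) := by
  set C := σ ^ 2 / σ + σ + (∫ p, p.2 ^ 2 ∂Pit) / σ with hC
  have hE : 0 ≤ ∫ p, p.2 ^ 2 ∂Pit := integral_nonneg fun p => by positivity
  have hC0 : 0 < C := by positivity
  set T := C + 1 with hT
  have hT0 : 0 < T := by positivity
  obtain ⟨B, hσB, hB⟩ := exists_B hσ hlam hκ hmom hT0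
  have hsub : Set.Icc σ B ⊆ Set.Ioi 0 := fun x hx => hσ.trans_le hx.1
  have hsub' : Set.Icc 0 T ⊆ Set.Ici 0 := fun x hx => hx.1
  have hconc : ∀ β, 0 < β → ConcaveOn ℝ (Set.Ici 0) (fun τ => scalarObj σ lam κ Pit τ β) :=
    fun β hβ => ((conc hlam hκ hmom hβ).strictConcaveOn (by norm_num)).concaveOn
  obtain ⟨b, hb, t, ht, hs⟩ := Sion.exists_isSaddlePointOn (X := Set.Icc σ B) (Y := Set.Icc 0 T)
    (f := fun β τ => scalarObj σ lam κ Pit τ β)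
    (Set.nonempty_Icc.2 hσB.le) (convex_Icc _ _) isCompact_Icc
    (fun τ hτ => ContinuousOn.lowerSemicontinuousOn fun x hx =>
      (hasDeriv hlam hκ hmom hτ.1 (hsub hx)).continuousAt.continuousWithinAt)
    (fun τ hτ => by
      apply ConvexOn.quasiconvexOn
      rcases hτ.1.eq_or_lt with h | h
      · simp only [← h, obj_zero]
        exact convexOn_const _ (convex_Icc _ _)
      · exact (strictConv hσ hlam hκ hmom h).convexOn.subset hsub (convex_Icc _ _))
    (convex_Icc _ _) (Set.nonempty_Icc.2 hT0.le) isCompact_Icc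
    (fun β hβ => ((cont_tau hlam hκ hmom (hsub hβ)).mono hsub').upperSemicontinuousOn)
    (fun β hβ => ((hconc β (hsub hβ)).subset hsub' (convex_Icc _ _)).quasiconcaveOn)
  have hb0 : 0 < b := hsub hb
  have ht0 : 0 ≤ t := ht.1
  have hs1 : ∀ τ ∈ Set.Icc 0 T, scalarObj σ lam κ Pit τ b ≤ scalarObj σ lam κ Pit t b :=
    fun τ hτ => hs b hb τ hτ
  have hs2 : ∀ β ∈ Set.Icc σ B, scalarObj σ lam κ Pit t b ≤ scalarObj σ lam κ Pit t β :=
    fun β hβ => hs β hβ t ht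
  have htC : t ≤ C := by
    by_contra hcon
    push Not at hcon
    have a1 := hs1 0 ⟨le_rfl, hT0.le⟩
    rw [obj_zero] at a1
    have a2 := hs2 σ ⟨le_rfl, hσB.le⟩
    have a3 := obj_le (σ := σ) hlam hκ hmom ht0 hσ
    rw [← hC] at a3
    nlinarith
  refine ⟨(t, b), ht0, hb0, ?_, ?_⟩
  · have : IsMaxOn (fun τ => scalarObj σ lam κ Pit τ b) (Set.Ici 0) t := by
      refine IsMaxOn.of_isLocalMaxOn_of_concaveOn ht0 ?_ (hconc b hb0)
      have : Set.Iio T ∈ nhdsWithin t (Set.Ici 0) :=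
        mem_nhdsWithin_of_mem_nhds (Iio_mem_nhds (by linarith))
      filter_upwards [this, self_mem_nhdsWithin] with x hx hx'
      exact hs1 x ⟨hx', le_of_lt hx⟩
    exact fun τ hτ => this hτ
  · intro β hβ
    rcases ht0.eq_or_lt with h | h
    · simp only [← h, obj_zero]; exact le_rfl
    · obtain ⟨b', h1, h2, h3⟩ := hB t h ht.2
      exact (hs2 b' ⟨h1, h2⟩).trans (crit_min hσ hlam hκ hmom h (hσ.trans_le h1) h3 hβ)

lemma saddle_pos {σ lam κ : ℝ} (hσ : 0 < σ) (hlam : 0 < lam) (hκ : 0 < κ)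
    {Pit : Measure (ℝ × ℝ)} [IsProbabilityMeasure Pit]
    (hmom : Integrable (fun p : ℝ × ℝ => p.2 ^ 2 + p.1 ^ 2) Pit) {t b : ℝ}
    (ht : 0 ≤ t) (hb : 0 < b)
    (h : ∀ τ ≥ (0 : ℝ), scalarObj σ lam κ Pit τ b ≤ scalarObj σ lam κ Pit t b) : 0 < t := by
  rcases ht.eq_or_lt with h0 | h0
  · obtain ⟨τ, hτ, hp⟩ := exists_pos hσ hlam hκ hmom hb
    have := h τ hτ.le
    rw [← h0, obj_zero] at this
    linarith
  · exact h0

/-- Let `σ, λ, κ > 0` and `Π` a probability distribution on ℝ² with `V ≠ 0`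
a.s. and `E[Θ² + V²] < ∞`. Then: (i) for each `β > 0`, `τ ↦ f(τ, β)` is strongly concave on
`[0, ∞)`; (ii) for each `τ > 0`, `β ↦ f(τ, β)` has a unique critical point on `(0, ∞)`,
characterized as the unique `β > 0` with `β² = σ² + E[(ÛV − Θ)²]` where
`Û = τV(Θ − β√κ G)/(τV² + βλ)` and `G ~ N(0,1)` is independent of `(V, Θ)`; and
(iii) the max–min problem admits a unique saddle point `(τ̂, β̂)` with `β̂ > 0`. -/
theorem scalar_max_min_saddle_point
    (σ lam κ : ℝ) (hσ : 0 < σ) (hlam : 0 < lam) (hκ : 0 < κ)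
    (Pit : Measure (ℝ × ℝ)) [IsProbabilityMeasure Pit]
    (hVne : ∀ᵐ p ∂Pit, p.1 ≠ 0)
    (hmom : Integrable (fun p : ℝ × ℝ => p.2 ^ 2 + p.1 ^ 2) Pit) :
    (∀ β > (0 : ℝ), ∃ m > (0 : ℝ),
      StrongConcaveOn (Set.Ici (0 : ℝ)) m (fun τ => scalarObj σ lam κ Pit τ β)) ∧
    (∀ τ > (0 : ℝ),
      (∃! β : ℝ, 0 < β ∧ deriv (fun β' => scalarObj σ lam κ Pit τ β') β = 0) ∧
      (∀ β > (0 : ℝ),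
        deriv (fun β' => scalarObj σ lam κ Pit τ β') β = 0 ↔
          β ^ 2 = σ ^ 2 +
            ∫ q, (τ * q.1.1 * (q.1.2 - β * Real.sqrt κ * q.2) / (τ * q.1.1 ^ 2 + β * lam)
                * q.1.1 - q.1.2) ^ 2 ∂(Pit.prod (gaussianReal 0 1)))) ∧
    (∃! pt : ℝ × ℝ, 0 ≤ pt.1 ∧ 0 < pt.2 ∧
      (∀ τ ≥ (0 : ℝ), scalarObj σ lam κ Pit τ pt.2 ≤ scalarObj σ lam κ Pit pt.1 pt.2) ∧
      (∀ β > (0 : ℝ), scalarObj σ lam κ Pit pt.1 pt.2 ≤ scalarObj σ lam κ Pit pt.1 β)) := by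

  refine ⟨fun β hβ => ⟨2, by norm_num, conc hlam hκ hmom hβ⟩, fun τ hτ => ⟨?_, ?_⟩, ?_⟩
  · obtain ⟨B, -, hB⟩ := exists_B hσ hlam hκ hmom hτ
    obtain ⟨b, h1, -, h3⟩ := hB τ hτ le_rfl
    have hb : 0 < b := hσ.trans_le h1
    refine ⟨b, ⟨hb, by rw [(hasDeriv hlam hκ hmom hτ.le hb).deriv, h3]⟩, ?_⟩
    rintro y ⟨hy, hy'⟩
    rw [(hasDeriv hlam hκ hmom hτ.le hy).deriv] at hy'
    rcases lt_trichotomy y b with h | h | h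
    · have := deriv_strictMono hσ hlam hκ hmom hτ hy h
      linarith
    · exact h
    · have := deriv_strictMono hσ hlam hκ hmom hτ hb h
      linarith
  · intro β hβ
    rw [(hasDeriv hlam hκ hmom hτ.le hβ).deriv, gauss_eq hlam hκ hmom hτ.le hβ]
    have hβ2 : β ^ 2 ≠ 0 := by positivity
    have e : β ^ 2 * (1 - σ ^ 2 / β ^ 2 - HH lam κ Pit τ β) =
        β ^ 2 - (σ ^ 2 + β ^ 2 * HH lam κ Pit τ β) := by
      field_simp
      ring
    rw [mul_eq_zero_iff_left hτ.ne', ← sub_eq_zero (a := β ^ 2), ← e, mul_eq_zero_iff_left hβ2]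
  · obtain ⟨⟨t, b⟩, ht, hb, h1, h2⟩ := exists_saddle hσ hlam hκ hmom (Pit := Pit)
    refine ⟨(t, b), ⟨ht, hb, h1, h2⟩, ?_⟩
    rintro ⟨t', b'⟩ ⟨ht', hb', h1', h2'⟩
    dsimp only at *
    have htp := saddle_pos hσ hlam hκ hmom ht hb h1
    have a1 := h1 t' ht'
    have a2 := h2 b' hb'
    have a3 := h1' t ht
    have a4 := h2' b hb
    have e1 : t' = t := by
      refine ((conc (σ := σ) hlam hκ hmom hb).strictConcaveOn (by norm_num)).eq_of_isMaxOn
        ?_ ?_ ht' ht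
      · intro τ hτ
        have := h1 τ hτ
        simp only [Set.mem_ofPred_eq]
        linarith
      · intro τ hτ
        exact h1 τ hτ
    have e2 : b' = b := by
      refine (strictConv hσ hlam hκ hmom htp (Pit := Pit)).eq_of_isMinOn ?_ ?_ hb' hb
      · intro β hβ
        have := h2 β hβ
        simp only [Set.mem_ofPred_eq]
        linarith
      · intro β hβ
        exact h2 β hβ
    rw [e1, e2]
end
end
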